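/- arXiv:2211.08123 — 2 statements merged into one kernel-verified Lean document; each statement's English description precedes it below -/
import Mathlib

section
/- Let q be an odd prime power with q ≥ 5. Then every irreducible complex character of SL₂(𝔽_q) has Knutson index 1 or 2; moreover, if q ≡ 1 (mod 4) then every irreducible character of degree q−1 has Knutson index exactly 2, and if q ≡ 3 (mod 4) then every irreducible character of degree q+1 has Knutson index exactly 2. In particular ℂ[SL₂(𝔽_q)] is not of Knutson type. -/
open scoped ComplexOrder

noncomputable section

/-- `χ : G → ℂ` is an irreducible character: the character of a simple
finite-dimensional complex representation of `G`. -/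
def IsIrrChar (G : Type) [Group G] (χ : G → ℂ) : Prop :=
  ∃ V : FDRep ℂ G, CategoryTheory.Simple V ∧ χ = V.character

/-- A virtual character is a `ℤ`-linear combination of irreducible characters. -/
def IsVirtualChar (G : Type) [Group G] (χ : G → ℂ) : Prop :=
  χ ∈ Submodule.span ℤ {f : G → ℂ | IsIrrChar G f}

open Classical in
/-- The regular character: `|G|` at the identity, `0` elsewhere. -/
def regChar (G : Type) [Group G] : G → ℂ :=
  fun g => if g = 1 then (Nat.card G : ℂ) else 0

/-- The Knutson index of `χ`: the least positive `n` such that `χ·φ = n·ρ_reg`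
for some virtual character `φ`. -/
def KnutsonIndex (G : Type) [Group G] (χ : G → ℂ) : ℕ :=
  sInf {n : ℕ | 0 < n ∧ ∃ φ : G → ℂ, IsVirtualChar G φ ∧ χ * φ = n • regChar G}

/-- `ℂ[G]` is of Knutson type: every irreducible character is regular invertible. -/
def IsKnutsonType (G : Type) [Group G] : Prop :=
  ∀ χ : G → ℂ, IsIrrChar G χ → ∃ φ : G → ℂ, IsVirtualChar G φ ∧ χ * φ = regChar G

/-- Savitskii's preorder: `φ ≤ χ` iff `φ(1) ≤ χ(1)` and every zero of `χ` is a zero of `φ`. -/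
def SavitskiiLE (G : Type) [Group G] (φ χ : G → ℂ) : Prop :=
  φ 1 ≤ χ 1 ∧ ∀ g : G, χ g = 0 → φ g = 0

/-- A virtual character of positive degree is Savitskii-minimal if every virtual
character of positive degree below it is also above it. -/
def SavitskiiMinimal (G : Type) [Group G] (χ : G → ℂ) : Prop :=
  ∀ φ : G → ℂ, IsVirtualChar G φ → 0 < φ 1 → SavitskiiLE G φ χ → SavitskiiLE G χ φ

end

namespace Knutson

open Representation Module

section General

variable {G : Type} [Group G]
variable {V : Type} [AddCommGroup V] [Module ℂ V]

theorem isIrreducible_iff (ρ : Representation ℂ G V) :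
    ρ.IsIrreducible ↔ Nontrivial V ∧
      ∀ W : Submodule ℂ V, (∀ g, ∀ v ∈ W, ρ g v ∈ W) → W = ⊥ ∨ W = ⊤ := by
  constructor
  · intro h
    refine ⟨?_, fun W hW => ?_⟩
    · by_contra hV
      rw [not_nontrivial_iff_subsingleton] at hV
      exact (bot_ne_top (α := Subrepresentation ρ))
        (Subrepresentation.toSubmodule_injective (Subsingleton.elim _ _))
    · rcases h.eq_bot_or_eq_top ⟨W, fun g v hv => hW g v hv⟩ with h | h
      · exact Or.inl (congrArg Subrepresentation.toSubmodule h)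
      · exact Or.inr (congrArg Subrepresentation.toSubmodule h)
  · rintro ⟨hV, h⟩
    have : Nontrivial (Subrepresentation ρ) :=
      ⟨⊥, ⊤, fun h => bot_ne_top (α := Submodule ℂ V) (congrArg Subrepresentation.toSubmodule h)⟩
    refine ⟨fun S => ?_⟩
    rcases h S.toSubmodule (fun g v hv => S.apply_mem_toSubmodule g hv) with h | h
    · exact Or.inl (Subrepresentation.toSubmodule_injective h)
    · exact Or.inr (Subrepresentation.toSubmodule_injective h)

theorem exists_isCompl_invariant [Finite G] (ρ : Representation ℂ G V) (W : Submodule ℂ V)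
    (hW : ∀ g, ∀ v ∈ W, ρ g v ∈ W) :
    ∃ W' : Submodule ℂ V, (∀ g, ∀ v ∈ W', ρ g v ∈ W') ∧ IsCompl W W' := by
  have : NeZero (Nat.card G : ℂ) := ⟨by simp [Nat.card_pos.ne']⟩
  obtain ⟨S, hS⟩ := exists_isCompl (⟨W, fun g v hv => hW g v hv⟩ : Subrepresentation ρ)
  refine ⟨S.toSubmodule, fun g v hv => S.apply_mem_toSubmodule g hv, ?_, ?_⟩
  · rw [disjoint_iff]
    exact congrArg Subrepresentation.toSubmodule hS.inf_eq_bot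
  · rw [codisjoint_iff]
    exact congrArg Subrepresentation.toSubmodule hS.sup_eq_top

theorem projection_comm (ρ : Representation ℂ G V) {W W' : Submodule ℂ V}
    (hW : ∀ g, ∀ v ∈ W, ρ g v ∈ W) (hW' : ∀ g, ∀ v ∈ W', ρ g v ∈ W') (hc : IsCompl W W')
    (g : G) (v : V) : W.projection W' hc (ρ g v) = ρ g (W.projection W' hc v) := by
  have hv := Submodule.projection_add_projection_eq_self hc v
  conv_lhs => rw [← hv]
  rw [map_add, map_add,
    Submodule.projection_apply_of_mem_left hc (hW g _ (Submodule.projection_apply_mem hc v)),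
    (Submodule.projection_apply_eq_zero_iff hc).2
      (hW' g _ (Submodule.projection_apply_mem hc.symm v)), add_zero]

theorem isIrreducible_of_sum_character [Fintype G] [FiniteDimensional ℂ V]
    (ρ : Representation ℂ G V)
    (h : ∑ g : G, ρ.character g * ρ.character g⁻¹ = Nat.card G) : ρ.IsIrreducible := by
  have hc : (Nat.card G : ℂ) ≠ 0 := by simp
  have : Invertible (Nat.card G : ℂ) := invertibleOfNonzero hc
  have h1 := card_inv_mul_sum_char_mul_char_eq_finrank ρ ρ
  rw [h, inv_mul_cancel₀ hc] at h1
  have h2 : finrank ℂ (IntertwiningMap ρ ρ) = 1 := by exact_mod_cast h1.symm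
  rw [isIrreducible_iff]
  have hV : Nontrivial V := by
    by_contra hV
    rw [not_nontrivial_iff_subsingleton] at hV
    have : Subsingleton (IntertwiningMap ρ ρ) := ⟨fun a b => by ext x; exact Subsingleton.elim _ _⟩
    rw [finrank_zero_of_subsingleton] at h2
    exact zero_ne_one h2
  refine ⟨hV, fun W hW => ?_⟩
  obtain ⟨W', hW', hc⟩ := exists_isCompl_invariant ρ W hW
  let p : IntertwiningMap ρ ρ := (W.projection W' hc).intertwiningMap_of_isIntertwiningMap _ _
    (projection_comm ρ hW hW' hc)
  let i : IntertwiningMap ρ ρ :=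
    (LinearMap.id : V →ₗ[ℂ] V).intertwiningMap_of_isIntertwiningMap _ _ (fun _ _ => rfl)
  have hi : i ≠ 0 := by
    intro h0
    obtain ⟨v, hv⟩ := exists_ne (0 : V)
    exact hv (congrArg (fun f : IntertwiningMap ρ ρ => f v) h0)
  obtain ⟨c, hcp⟩ := (finrank_eq_one_iff_of_nonzero' i hi).1 h2 p
  have hp : ∀ v, W.projection W' hc v = c • v := fun v =>
    (congrArg (fun f : IntertwiningMap ρ ρ => f v) hcp).symm
  by_cases h0 : c = 0
  · left
    rw [Submodule.eq_bot_iff]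
    intro v hv
    rw [← Submodule.projection_apply_of_mem_left hc hv, hp, h0, zero_smul]
  · right
    rw [Submodule.eq_top_iff']
    intro v
    have := Submodule.projection_apply_mem hc v
    rw [hp] at this
    exact (W.smul_mem_iff h0).1 this

theorem isIrrChar_iff [Finite G] (χ : G → ℂ) :
    IsIrrChar G χ ↔ ∃ (V : Type) (_ : AddCommGroup V) (_ : Module ℂ V) (_ : FiniteDimensional ℂ V)
      (ρ : Representation ℂ G V), ρ.IsIrreducible ∧ χ = ρ.character := by
  have := Fintype.ofFinite G
  have hc : (Nat.card G : ℂ) ≠ 0 := by simp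
  have : Invertible (Nat.card G : ℂ) := invertibleOfNonzero hc
  constructor
  · rintro ⟨V, hV, rfl⟩
    refine ⟨V, inferInstance, inferInstance, inferInstance, V.ρ, ?_, rfl⟩
    exact isIrreducible_of_sum_character _ ((FDRep.simple_iff_char_is_norm_one V).1 hV)
  · rintro ⟨V, _, _, _, ρ, hρ, rfl⟩
    refine ⟨FDRep.of ρ, ?_, rfl⟩
    rw [FDRep.simple_iff_char_is_norm_one]
    have := char_orthonormal ρ ρ
    rw [if_pos ⟨Representation.Equiv.refl ρ⟩, inv_mul_eq_iff_eq_mul₀ hc, mul_one] at this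
    exact this

/-- The restriction of a representation to an invariant subspace. -/
abbrev restr (ρ : Representation ℂ G V) (W : Submodule ℂ V) (hW : ∀ g, ∀ v ∈ W, ρ g v ∈ W) :
    Representation ℂ G W :=
  Subrepresentation.toRepresentation (⟨W, fun g v hv => hW g v hv⟩ : Subrepresentation ρ)

theorem restr_apply (ρ : Representation ℂ G V) (W : Submodule ℂ V)
    (hW : ∀ g, ∀ v ∈ W, ρ g v ∈ W) (g : G) (v : W) : (restr ρ W hW g v : V) = ρ g v := rfl

theorem character_eq_add (ρ : Representation ℂ G V) [FiniteDimensional ℂ V] {W W' : Submodule ℂ V}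
    (hW : ∀ g, ∀ v ∈ W, ρ g v ∈ W) (hW' : ∀ g, ∀ v ∈ W', ρ g v ∈ W') (hc : IsCompl W W') :
    ρ.character = (restr ρ W hW).character + (restr ρ W' hW').character := by
  ext g
  have := LinearMap.trace_conj' (R := ℂ) (LinearMap.prodMap (restr ρ W hW g) (restr ρ W' hW' g))
    (Submodule.prodEquivOfIsCompl W W' hc)
  rw [LinearMap.trace_prodMap'] at this
  change LinearMap.trace ℂ V (ρ g) = _
  rw [Pi.add_apply]
  refine Eq.trans ?_ this
  congr 1
  ext v
  obtain ⟨w, rfl⟩ := (Submodule.prodEquivOfIsCompl W W' hc).surjective v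
  simp [LinearEquiv.conj_apply, restr_apply]

/-- An induction principle for finite-dimensional representations of a finite group. -/
theorem rep_induction [Finite G]
    {P : ∀ (V : Type) [AddCommGroup V] [Module ℂ V] [FiniteDimensional ℂ V],
      Representation ℂ G V → Prop}
    (zero : ∀ (V : Type) [AddCommGroup V] [Module ℂ V] [FiniteDimensional ℂ V]
      (ρ : Representation ℂ G V), Subsingleton V → P V ρ)
    (irr : ∀ (V : Type) [AddCommGroup V] [Module ℂ V] [FiniteDimensional ℂ V]
      (ρ : Representation ℂ G V), ρ.IsIrreducible → P V ρ)
    (sum : ∀ (V : Type) [AddCommGroup V] [Module ℂ V] [FiniteDimensional ℂ V]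
      (ρ : Representation ℂ G V) (W W' : Submodule ℂ V) (hW : ∀ g, ∀ v ∈ W, ρ g v ∈ W)
      (hW' : ∀ g, ∀ v ∈ W', ρ g v ∈ W') (_ : IsCompl W W'),
      P W (restr ρ W hW) → P W' (restr ρ W' hW') → P V ρ)
    (V : Type) [AddCommGroup V] [Module ℂ V] [FiniteDimensional ℂ V]
    (ρ : Representation ℂ G V) : P V ρ := by
  induction hn : finrank ℂ V using Nat.strong_induction_on generalizing V with
  | _ n ih =>
  by_cases hV : Subsingleton V
  · exact zero V ρ hV
  rw [not_subsingleton_iff_nontrivial] at hV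
  by_cases hirr : ρ.IsIrreducible
  · exact irr V ρ hirr
  rw [isIrreducible_iff] at hirr
  push Not at hirr
  obtain ⟨W, hW, hb, ht⟩ := hirr hV
  obtain ⟨W', hW', hc⟩ := exists_isCompl_invariant ρ W hW
  have h1 := Submodule.finrank_lt ht
  have h2 : finrank ℂ W' < finrank ℂ V := Submodule.finrank_lt fun h => hb (by
    have := hc.inf_eq_bot
    rwa [h, inf_top_eq] at this)
  exact sum V ρ W W' hW hW' hc (ih _ (hn ▸ h1) W _ rfl) (ih _ (hn ▸ h2) W' _ rfl)

theorem isVirtualChar_character [Finite G] [FiniteDimensional ℂ V] (ρ : Representation ℂ G V) :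
    IsVirtualChar G ρ.character := by
  refine rep_induction (P := fun V _ _ _ ρ => IsVirtualChar G ρ.character) ?_ ?_ ?_ V ρ
  · intro V _ _ _ ρ hV
    have : ρ.character = 0 := by
      ext g
      change LinearMap.trace ℂ V (ρ g) = 0
      rw [Subsingleton.elim (ρ g) 0, map_zero]
    rw [this]
    exact Submodule.zero_mem _
  · intro V _ _ _ ρ hρ
    exact Submodule.subset_span ((isIrrChar_iff _).2 ⟨V, _, _, ‹_›, ρ, hρ, rfl⟩)
  · intro V _ _ _ ρ W W' hW hW' hc h1 h2
    rw [character_eq_add ρ hW hW' hc]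
    exact Submodule.add_mem _ h1 h2

theorem exists_irreducible_ne_zero [Finite G] (x : MonoidAlgebra ℂ G) (hx : x ≠ 0) :
    ∃ (V : Type) (_ : AddCommGroup V) (_ : Module ℂ V) (_ : FiniteDimensional ℂ V)
      (ρ : Representation ℂ G V), ρ.IsIrreducible ∧ ρ.asAlgebraHom x ≠ 0 := by
  by_contra! hcon
  have key : ∀ (V : Type) [AddCommGroup V] [Module ℂ V] [FiniteDimensional ℂ V]
      (ρ : Representation ℂ G V), ρ.asAlgebraHom x = 0 := by
    intro V _ _ _ ρ
    refine rep_induction (P := fun V _ _ _ ρ => ρ.asAlgebraHom x = 0) ?_ ?_ ?_ V ρ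
    · intro V _ _ _ ρ hV
      exact Subsingleton.elim _ _
    · intro V _ _ _ ρ hρ
      exact hcon V _ _ ‹_› ρ hρ
    · intro V _ _ _ ρ W W' hW hW' hc h1 h2
      have aux : ∀ (W : Submodule ℂ V) (hW : ∀ g, ∀ v ∈ W, ρ g v ∈ W)
          (y : MonoidAlgebra ℂ G) (v : W),
          ((restr ρ W hW).asAlgebraHom y v : V) = ρ.asAlgebraHom y v := by
        intro W hW y v
        induction y using MonoidAlgebra.induction_linear with
        | zero => simp
        | add y z hy hz => simp [hy, hz]
        | single g r => simp [restr_apply]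
      ext v
      rw [← Submodule.projection_add_projection_eq_self hc v, map_add]
      have e1 := aux W hW x ⟨_, Submodule.projection_apply_mem hc v⟩
      have e2 := aux W' hW' x ⟨_, Submodule.projection_apply_mem hc.symm v⟩
      rw [h1] at e1
      rw [h2] at e2
      simp only [LinearMap.zero_apply, ZeroMemClass.coe_zero] at e1 e2
      rw [← e1, ← e2, add_zero, LinearMap.zero_apply]
  apply hx
  have : FiniteDimensional ℂ (MonoidAlgebra ℂ G) :=
    Module.Finite.equiv (MonoidAlgebra.coeffLinearEquiv (R := ℂ) (S := ℂ) (M := G)).symm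
  let σ : Representation ℂ G (MonoidAlgebra ℂ G) :=
    ((Algebra.lmul ℂ (MonoidAlgebra ℂ G)).toMonoidHom).comp (MonoidAlgebra.of ℂ G)
  have h1 : σ.asAlgebraHom = Algebra.lmul ℂ (MonoidAlgebra ℂ G) := by
    ext g
    simp [σ]
  have h2 := congrArg (fun f => f 1) (key _ σ)
  rw [h1] at h2
  simpa using h2

end General

section Projectors

variable {A : Type} [Group A] [Fintype A] {𝒜 : Type*} [Ring 𝒜] [Algebra ℂ 𝒜]

/-- The projector onto the `l`-isotypic part of a finite group acting through `φ`. -/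
noncomputable def isoProj (φ : A →* 𝒜) (l : A →* ℂ) : 𝒜 :=
  (Fintype.card A : ℂ)⁻¹ • ∑ a, l a⁻¹ • φ a

theorem mul_isoProj (φ : A →* 𝒜) (l : A →* ℂ) (a : A) :
    φ a * isoProj φ l = l a • isoProj φ l := by
  rw [isoProj, mul_smul_comm, smul_comm (l a), Finset.mul_sum, Finset.smul_sum (r := l a)]
  congr 1
  refine Fintype.sum_equiv (Equiv.mulLeft a) _ _ fun b => ?_
  rw [Equiv.coe_mulLeft, map_mul, mul_inv_rev, map_mul, mul_smul_comm, smul_smul,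
    mul_comm (l b⁻¹), ← mul_assoc, ← map_mul l, mul_inv_cancel, map_one, one_mul]

theorem isoProj_mul (φ : A →* 𝒜) (l : A →* ℂ) (a : A) :
    isoProj φ l * φ a = l a • isoProj φ l := by
  rw [isoProj, smul_mul_assoc, smul_comm (l a), Finset.sum_mul, Finset.smul_sum (r := l a)]
  congr 1
  refine Fintype.sum_equiv (Equiv.mulRight a) _ _ fun b => ?_
  rw [Equiv.coe_mulRight, map_mul, mul_inv_rev, map_mul, smul_mul_assoc, smul_smul,
    ← mul_assoc, ← map_mul l, mul_inv_cancel, map_one, one_mul]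

theorem isoProj_mul_of_forall (φ : A →* 𝒜) (l : A →* ℂ) {x : 𝒜} (hx : ∀ a, φ a * x = l a • x) :
    isoProj φ l * x = x := by
  rw [isoProj, smul_mul_assoc, Finset.sum_mul]
  have : ∀ a ∈ Finset.univ, l a⁻¹ • φ a * x = x := by
    intro a _
    rw [smul_mul_assoc, hx, smul_smul, ← map_mul, inv_mul_cancel, map_one, one_smul]
  rw [Finset.sum_congr rfl this, Finset.sum_const, Finset.card_univ, ← Nat.cast_smul_eq_nsmul ℂ,
    smul_smul, inv_mul_cancel₀ (by simp), one_smul]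

theorem isIdempotentElem_isoProj (φ : A →* 𝒜) (l : A →* ℂ) : IsIdempotentElem (isoProj φ l) :=
  isoProj_mul_of_forall φ l (mul_isoProj φ l)

theorem map_isoProj {ℬ : Type*} [Ring ℬ] [Algebra ℂ ℬ] (F : 𝒜 →ₐ[ℂ] ℬ) (φ : A →* 𝒜)
    (l : A →* ℂ) : F (isoProj φ l) = isoProj ((F : 𝒜 →* ℬ).comp φ) l := by
  simp [isoProj]

end Projectors

section Traces

variable {V : Type*} [AddCommGroup V] [Module ℂ V] [FiniteDimensional ℂ V]

theorem trace_eq_finrank_range {e : Module.End ℂ V} (he : IsIdempotentElem e) :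
    LinearMap.trace ℂ V e = finrank ℂ (LinearMap.range e) :=
  (LinearMap.IsIdempotentElem.isProj_range e he).trace

theorem exists_nat_trace_eq {e : Module.End ℂ V} (he : IsIdempotentElem e) :
    ∃ n : ℕ, LinearMap.trace ℂ V e = n := ⟨_, trace_eq_finrank_range he⟩

theorem trace_restrict_range {e f : Module.End ℂ V} (he : IsIdempotentElem e)
    (hf : ∀ v ∈ LinearMap.range e, f v ∈ LinearMap.range e) :
    LinearMap.trace ℂ _ (f.restrict hf) = LinearMap.trace ℂ V (f * e) := by
  have h1 : ∀ v, (f * e) v ∈ LinearMap.range e := fun v => hf _ ⟨v, rfl⟩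
  rw [← LinearMap.trace_restrict_eq_of_forall_mem (LinearMap.range e) (f * e) h1]
  congr 1
  ext ⟨v, w, rfl⟩
  have := LinearMap.congr_fun he.eq w
  simp only [Module.End.mul_apply] at this
  simp [this]

end Traces

section Virtual

variable {G : Type} [Group G]

theorem trace_isoProj {A : Type} [Group A] [Fintype A] {V : Type*} [AddCommGroup V] [Module ℂ V]
    (ρ : Representation ℂ G V) (f : A →* G) (l : A →* ℂ) :
    LinearMap.trace ℂ V (isoProj (MonoidHom.comp ρ f) l) =
      (Fintype.card A : ℂ)⁻¹ * ∑ a, l a⁻¹ * ρ.character (f a) := by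
  simp [isoProj, Representation.character]

open Classical in
/-- The function induced from a function on a finite group `A` along `f : A →* G`. -/
noncomputable def indFun [Fintype G] {A : Type} [Group A] [Fintype A] (f : A →* G) (ψ : A → ℂ) :
    G → ℂ :=
  fun g => (Fintype.card A : ℂ)⁻¹ *
    ∑ a, ψ a * ((Finset.univ.filter fun x : G => x * f a * x⁻¹ = g).card : ℂ)

theorem indFun_add [Fintype G] {A : Type} [Group A] [Fintype A] (f : A →* G) (ψ ψ' : A → ℂ) :
    indFun f (ψ + ψ') = indFun f ψ + indFun f ψ' := by
  ext g
  simp [indFun, add_mul, Finset.sum_add_distrib, mul_add]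

/-- The right regular representation on functions. -/
def rightReg (G : Type) [Group G] : Representation ℂ G (G → ℂ) where
  toFun h := { toFun := fun ξ x => ξ (x * h), map_add' := fun _ _ => rfl,
               map_smul' := fun _ _ => rfl }
  map_one' := by ext; simp
  map_mul' a b := by
    refine LinearMap.ext fun ξ => funext fun x => ?_
    simp [mul_assoc]

/-- The left regular representation on functions. -/
def leftReg (G : Type) [Group G] : Representation ℂ G (G → ℂ) where
  toFun h := { toFun := fun ξ x => ξ (h⁻¹ * x), map_add' := fun _ _ => rfl,
               map_smul' := fun _ _ => rfl }
  map_one' := by ext; simp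
  map_mul' a b := by
    refine LinearMap.ext fun ξ => funext fun x => ?_
    simp [mul_assoc]

theorem leftReg_commute_rightReg (g h : G) : Commute (leftReg G g) (rightReg G h) := by
  refine LinearMap.ext fun ξ => funext fun x => ?_
  simp [leftReg, rightReg, mul_assoc]

open Classical in
theorem trace_leftReg_mul_rightReg [Fintype G] (g h : G) :
    LinearMap.trace ℂ (G → ℂ) (leftReg G g * rightReg G h) =
      ((Finset.univ.filter fun x : G => x * h * x⁻¹ = g).card : ℂ) := by
  rw [LinearMap.trace_eq_matrix_trace ℂ (Pi.basisFun ℂ G), Matrix.trace, Finset.card_filter,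
    Nat.cast_sum]
  refine Finset.sum_congr rfl fun x _ => ?_
  simp only [Matrix.diag_apply, LinearMap.toMatrix_apply, Pi.basisFun_apply, Pi.basisFun_repr]
  simp only [leftReg, rightReg, MonoidHom.coe_mk, OneHom.coe_mk, Module.End.mul_apply,
    LinearMap.coe_mk, AddHom.coe_mk, Pi.single_apply, Nat.cast_ite, Nat.cast_one, Nat.cast_zero]
  congr 1
  rw [mul_assoc, inv_mul_eq_iff_eq_mul, mul_inv_eq_iff_eq_mul]

theorem isVirtualChar_indFun [Fintype G] {A : Type} [Group A] [Fintype A] (f : A →* G)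
    (l : A →* ℂ) : IsVirtualChar G (indFun f fun a => l a⁻¹) := by
  classical
  set p := isoProj (MonoidHom.comp (rightReg G) f) l with hp
  have hid : IsIdempotentElem p := isIdempotentElem_isoProj _ _
  have hcomm : ∀ g, Commute (leftReg G g) p := by
    intro g
    rw [hp, isoProj]
    exact (Commute.sum_right _ _ _ fun a _ =>
      ((leftReg_commute_rightReg g (f a)).smul_right _)).smul_right _
  have hinv : ∀ g, ∀ v ∈ LinearMap.range p, leftReg G g v ∈ LinearMap.range p := by
    rintro g _ ⟨w, rfl⟩
    exact ⟨leftReg G g w, (LinearMap.congr_fun (hcomm g).eq w).symm⟩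
  convert isVirtualChar_character (restr (leftReg G) (LinearMap.range p) hinv) using 1
  ext g
  refine Eq.trans ?_ (trace_restrict_range hid (hinv g)).symm
  simp [hp, isoProj, indFun, Finset.mul_sum, trace_leftReg_mul_rightReg]

theorem mul_indFun_eq_nsmul_regChar [Fintype G] {A : Type} [Group A] [Fintype A] (f : A →* G)
    (ψ : A → ℂ) (χ : G → ℂ) (hχ : ∀ g h, χ (h * g * h⁻¹) = χ g)
    (hz : ∀ a, a ≠ 1 → χ (f a) * ψ a = 0) (n : ℕ) (hn : (n : ℂ) * Fintype.card A = χ 1 * ψ 1) :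
    χ * indFun f ψ = n • regChar G := by
  classical
  have hA : (Fintype.card A : ℂ) ≠ 0 := by simp
  ext g
  have h1 : ∑ a, χ g * (ψ a * ((Finset.univ.filter fun x : G => x * f a * x⁻¹ = g).card : ℂ)) =
      χ g * (ψ 1 * ((Finset.univ.filter fun x : G => x * f 1 * x⁻¹ = g).card : ℂ)) := by
    refine Finset.sum_eq_single _ (fun a _ ha => ?_) (by simp)
    rcases (Finset.univ.filter fun x : G => x * f a * x⁻¹ = g).eq_empty_or_nonempty with h | ⟨x, hx⟩
    · simp [h]
    · rw [Finset.mem_filter] at hx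
      rw [← hx.2, hχ, ← mul_assoc, hz a ha, zero_mul]
  have h2 : (χ * indFun f ψ) g = (Fintype.card A : ℂ)⁻¹ *
      ∑ a, χ g * (ψ a * ((Finset.univ.filter fun x : G => x * f a * x⁻¹ = g).card : ℂ)) := by
    rw [← Finset.mul_sum, Pi.mul_apply, indFun]
    ring
  rw [h2, h1]
  by_cases hg : g = 1
  · subst hg
    simp only [map_one, mul_one, mul_inv_cancel, Finset.filter_true, Finset.card_univ, regChar,
      Pi.smul_apply, if_true, nsmul_eq_mul, Nat.card_eq_fintype_card]
    rw [← mul_assoc, ← mul_assoc, mul_assoc _ (χ 1), ← hn, mul_comm (n : ℂ), ← mul_assoc,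
      inv_mul_cancel₀ hA, one_mul]
  · simp [regChar, hg, Ne.symm hg]

theorem knutsonIndex_eq_one {χ φ : G → ℂ} (hφ : IsVirtualChar G φ)
    (h : χ * φ = 1 • regChar G) : KnutsonIndex G χ = 1 := by
  have hmem : 1 ∈ {n : ℕ | 0 < n ∧ ∃ φ : G → ℂ, IsVirtualChar G φ ∧ χ * φ = n • regChar G} :=
    ⟨one_pos, φ, hφ, h⟩
  have h1 := Nat.sInf_le hmem
  have h2 := (Nat.sInf_mem ⟨1, hmem⟩).1
  exact le_antisymm h1 h2

theorem knutsonIndex_eq_one_or_two {χ φ : G → ℂ} (hφ : IsVirtualChar G φ)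
    (h : χ * φ = 2 • regChar G) : KnutsonIndex G χ = 1 ∨ KnutsonIndex G χ = 2 := by
  have hmem : 2 ∈ {n : ℕ | 0 < n ∧ ∃ φ : G → ℂ, IsVirtualChar G φ ∧ χ * φ = n • regChar G} :=
    ⟨two_pos, φ, hφ, h⟩
  have h1 : KnutsonIndex G χ ≤ 2 := Nat.sInf_le hmem
  have h2 : 0 < KnutsonIndex G χ := (Nat.sInf_mem ⟨2, hmem⟩).1
  omega

theorem exists_of_knutsonIndex_eq_one {χ : G → ℂ} (h : KnutsonIndex G χ = 1) :
    ∃ φ : G → ℂ, IsVirtualChar G φ ∧ χ * φ = regChar G := by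
  have hne : {n : ℕ | 0 < n ∧ ∃ φ : G → ℂ, IsVirtualChar G φ ∧ χ * φ = n • regChar G}.Nonempty := by
    by_contra hcon
    rw [Set.not_nonempty_iff_eq_empty] at hcon
    rw [KnutsonIndex, hcon, Nat.sInf_empty] at h
    exact zero_ne_one h
  have := (Nat.sInf_mem hne).2
  rw [show sInf _ = 1 from h] at this
  simpa using this

end Virtual

section Schur

variable {G : Type} [Group G] {V : Type} [AddCommGroup V] [Module ℂ V] [FiniteDimensional ℂ V]
  {ρ : Representation ℂ G V}

omit [FiniteDimensional ℂ V] in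
theorem eq_top_of_irreducible (hρ : ρ.IsIrreducible) {W : Submodule ℂ V}
    (hW : ∀ g, ∀ v ∈ W, ρ g v ∈ W) {v : V} (hv : v ∈ W) (h0 : v ≠ 0) : W = ⊤ := by
  refine (((isIrreducible_iff ρ).1 hρ).2 W hW).resolve_left ?_
  rintro rfl
  exact h0 ((Submodule.mem_bot ℂ).1 hv)

omit [FiniteDimensional ℂ V] in
theorem span_orbit_eq_top (hρ : ρ.IsIrreducible) {v : V} (h0 : v ≠ 0) :
    Submodule.span ℂ (Set.range fun g => ρ g v) = ⊤ := by
  refine eq_top_of_irreducible hρ (fun g w hw => ?_)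
    (Submodule.subset_span ⟨1, by simp⟩) h0
  induction hw using Submodule.span_induction with
  | mem x hx =>
    obtain ⟨h, rfl⟩ := hx
    exact Submodule.subset_span ⟨g * h, by simp⟩
  | zero => simp
  | add x y _ _ hx hy => rw [map_add]; exact add_mem hx hy
  | smul c x _ hx => rw [map_smul]; exact Submodule.smul_mem _ _ hx

theorem exists_eq_smul_of_commute (hρ : ρ.IsIrreducible) (T : Module.End ℂ V)
    (hT : ∀ g v, T (ρ g v) = ρ g (T v)) : ∃ c : ℂ, ∀ v, T v = c • v := by
  have : Nontrivial V := ((isIrreducible_iff ρ).1 hρ).1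
  obtain ⟨c, hc⟩ := Module.End.exists_eigenvalue T
  obtain ⟨v, hv⟩ := hc.exists_hasEigenvector
  refine ⟨c, fun w => ?_⟩
  have htop : T.eigenspace c = ⊤ := eq_top_of_irreducible hρ (fun g v hv => by
    rw [Module.End.mem_eigenspace_iff] at hv ⊢
    rw [hT, hv, map_smul]) hv.1 hv.2
  exact Module.End.mem_eigenspace_iff.1 (htop ▸ Submodule.mem_top)

theorem character_eq_zero_of_sum_conj [Fintype G] (hρ : ρ.IsIrreducible) {g : G}
    (E : Module.End ℂ V) {v : V} (hv : E v ≠ 0) (h : E (∑ h, ρ (h * g * h⁻¹) v) = 0) :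
    ρ.character g = 0 := by
  set T : Module.End ℂ V := ∑ h, ρ (h * g * h⁻¹) with hT
  obtain ⟨c, hc⟩ := exists_eq_smul_of_commute hρ T (fun k v => by
    simp only [hT, LinearMap.sum_apply, map_sum]
    refine Fintype.sum_equiv (Equiv.mulLeft k⁻¹) _ _ fun h => ?_
    rw [← Module.End.mul_apply, ← Module.End.mul_apply, ← map_mul, ← map_mul]
    congr 2
    simp [mul_assoc])
  have h0 : c = 0 := by
    have h1 : T v = ∑ h, ρ (h * g * h⁻¹) v := by simp [hT]
    rw [← h1, hc, map_smul] at h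
    exact (smul_eq_zero.1 h).resolve_right hv
  have h2 : LinearMap.trace ℂ V T = Fintype.card G * ρ.character g := by
    rw [hT, map_sum]
    have : ∀ h ∈ Finset.univ, LinearMap.trace ℂ V (ρ (h * g * h⁻¹)) = ρ.character g :=
      fun h _ => char_conj ρ g h
    rw [Finset.sum_congr rfl this]
    simp
  have h3 : T = 0 := by
    ext v
    rw [hc, h0, zero_smul, LinearMap.zero_apply]
  rw [h3, map_zero] at h2
  exact (mul_eq_zero.1 h2.symm).resolve_left (by simp)

theorem finrank_range_le_one (hρ : ρ.IsIrreducible) {e : Module.End ℂ V}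
    (he : IsIdempotentElem e)
    (hcomm : ∀ g h, Commute (e * ρ g * e) (e * ρ h * e)) :
    finrank ℂ (LinearMap.range e) ≤ 1 := by
  have hee : ∀ v, e (e v) = e v := LinearMap.congr_fun he.eq
  have hspan : ∀ {v : V}, v ≠ 0 → e v = v → ∀ (W : Submodule ℂ V),
      (∀ g, e (ρ g v) ∈ W) → LinearMap.range e ≤ W := by
    rintro v hv hev W hW _ ⟨x, rfl⟩
    have hx : x ∈ Submodule.span ℂ (Set.range fun g => ρ g v) := by
      rw [span_orbit_eq_top hρ hv]; exact Submodule.mem_top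
    have : Submodule.span ℂ (Set.range fun g => ρ g v) ≤ W.comap e := by
      rw [Submodule.span_le]
      rintro _ ⟨g, rfl⟩
      exact hW g
    exact this hx
  by_cases hb : LinearMap.range e = ⊥
  · rw [hb]; simp
  have hnt : Nontrivial (LinearMap.range e) := Submodule.nontrivial_iff_ne_bot.2 hb
  have hscal : ∀ g, ∃ c : ℂ, ∀ v ∈ LinearMap.range e, e (ρ g v) = c • v := by
    intro g
    let T : Module.End ℂ (LinearMap.range e) :=
      (e * ρ g).restrict (fun v _ => ⟨ρ g v, rfl⟩)
    obtain ⟨c, hc⟩ := Module.End.exists_eigenvalue T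
    obtain ⟨⟨v, hvr⟩, hv⟩ := hc.exists_hasEigenvector
    have hev : e v = v := by
      obtain ⟨x, rfl⟩ := hvr; exact hee x
    have hTv : e (ρ g v) = c • v := congrArg Subtype.val hv.apply_eq_smul
    have hv0 : v ≠ 0 := fun h => hv.2 (Subtype.ext h)
    refine ⟨c, fun w hw => ?_⟩
    have hle := hspan hv0 hev ((e * ρ g * e).eigenspace c ⊓ LinearMap.range e) (fun h => by
      refine ⟨?_, ⟨_, rfl⟩⟩
      change _ ∈ (e * ρ g * e).eigenspace c
      rw [Module.End.mem_eigenspace_iff]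
      have := LinearMap.congr_fun (hcomm g h).eq v
      simp only [Module.End.mul_apply, hee, hev, hTv, map_smul] at this ⊢
      exact this)
    have h1 := (hle hw).1
    change _ ∈ (e * ρ g * e).eigenspace c at h1
    rw [Module.End.mem_eigenspace_iff] at h1
    obtain ⟨x, rfl⟩ := hw
    simpa [hee] using h1
  obtain ⟨⟨v, hvr⟩, hv⟩ := exists_ne (0 : LinearMap.range e)
  have hv0 : v ≠ 0 := fun h => hv (Subtype.ext h)
  have hev : e v = v := by
    obtain ⟨x, rfl⟩ := hvr; exact hee x
  have hle := hspan hv0 hev (Submodule.span ℂ {v}) (fun g => by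
    obtain ⟨c, hc⟩ := hscal g
    rw [hc v hvr]
    exact Submodule.smul_mem _ _ (Submodule.mem_span_singleton_self v))
  calc _ ≤ finrank ℂ (Submodule.span ℂ {v}) := Submodule.finrank_mono hle
    _ ≤ 1 := (finrank_span_singleton hv0).le

end Schur

section Elements

variable {F : Type} [Field F]

/-- The group `SL₂(F)`. -/
abbrev SL (F : Type) [Field F] : Type := Matrix.SpecialLinearGroup (Fin 2) F

theorem sl_ext {g h : SL F} (h00 : g 0 0 = h 0 0) (h01 : g 0 1 = h 0 1) (h10 : g 1 0 = h 1 0)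
    (h11 : g 1 1 = h 1 1) : g = h := by
  ext i j
  fin_cases i <;> fin_cases j <;> assumption

theorem sl_det (g : SL F) : g 0 0 * g 1 1 - g 0 1 * g 1 0 = 1 := by
  have := g.det_coe
  rwa [Matrix.det_fin_two] at this

/-- The matrix with the given entries. -/
def mk (a b c d : F) (h : a * d - b * c = 1) : SL F :=
  ⟨!![a, b; c, d], by rw [Matrix.det_fin_two_of, h]⟩

section
variable (a b c d : F) (h : a * d - b * c = 1)
@[simp] theorem mk_00 : mk a b c d h 0 0 = a := rfl
@[simp] theorem mk_01 : mk a b c d h 0 1 = b := rfl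
@[simp] theorem mk_10 : mk a b c d h 1 0 = c := rfl
@[simp] theorem mk_11 : mk a b c d h 1 1 = d := rfl
end

theorem mul_apply (g h : SL F) (i j : Fin 2) : (g * h) i j = g i 0 * h 0 j + g i 1 * h 1 j := by
  rw [Matrix.SpecialLinearGroup.coe_mul, Matrix.mul_apply, Fin.sum_univ_two]

theorem inv_00 (g : SL F) : g⁻¹ 0 0 = g 1 1 := by
  simp [Matrix.SpecialLinearGroup.coe_inv, Matrix.adjugate_fin_two]
theorem inv_01 (g : SL F) : g⁻¹ 0 1 = -g 0 1 := by
  simp [Matrix.SpecialLinearGroup.coe_inv, Matrix.adjugate_fin_two]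
theorem inv_10 (g : SL F) : g⁻¹ 1 0 = -g 1 0 := by
  simp [Matrix.SpecialLinearGroup.coe_inv, Matrix.adjugate_fin_two]
theorem inv_11 (g : SL F) : g⁻¹ 1 1 = g 0 0 := by
  simp [Matrix.SpecialLinearGroup.coe_inv, Matrix.adjugate_fin_two]

/-- The unipotent subgroup. -/
def uHom : Multiplicative F →* SL F where
  toFun x := mk 1 x.toAdd 0 1 (by ring)
  map_one' := by apply sl_ext <;> simp
  map_mul' x y := by apply sl_ext <;> simp [mul_apply, add_comm]

/-- The split torus. -/
def hh : Fˣ →* SL F where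
  toFun a := mk a 0 0 (a⁻¹ : Fˣ) (by simp)
  map_one' := by apply sl_ext <;> simp
  map_mul' x y := by apply sl_ext <;> simp [mul_apply, mul_comm]

/-- Upper unitriangular matrices. -/
def uu (x : F) : SL F := uHom (Multiplicative.ofAdd x)

/-- The Weyl element. -/
def ww : SL F := mk 0 1 (-1) 0 (by ring)

section
variable (x : F) (a : Fˣ)
@[simp] theorem uu_00 : uu x 0 0 = 1 := rfl
@[simp] theorem uu_01 : uu x 0 1 = x := rfl
@[simp] theorem uu_10 : uu x 1 0 = 0 := rfl
@[simp] theorem uu_11 : uu x 1 1 = 1 := rfl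
@[simp] theorem hh_00 : hh a 0 0 = a := rfl
@[simp] theorem hh_01 : hh a 0 1 = 0 := rfl
@[simp] theorem hh_10 : hh a 1 0 = 0 := rfl
@[simp] theorem hh_11 : hh a 1 1 = (a : F)⁻¹ := by simp [hh]
@[simp] theorem ww_00 : (ww : SL F) 0 0 = 0 := rfl
@[simp] theorem ww_01 : (ww : SL F) 0 1 = 1 := rfl
@[simp] theorem ww_10 : (ww : SL F) 1 0 = -1 := rfl
@[simp] theorem ww_11 : (ww : SL F) 1 1 = 0 := rfl
end

@[simp] theorem uu_zero : uu (0 : F) = 1 := map_one uHom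

theorem hh_mul_uu (a : Fˣ) (x : F) : hh a * uu x = uu (a ^ 2 * x) * hh a := by
  apply sl_ext <;> simp [mul_apply]
  field_simp

theorem hh_mul_ww (a : Fˣ) : hh a * ww = ww * hh a⁻¹ := by
  apply sl_ext <;> simp [mul_apply, -map_inv]

theorem ww_mul_ww : (ww : SL F) * ww = -1 := by
  apply sl_ext <;> simp [mul_apply]

theorem neg_one_comm (g : SL F) : -1 * g = g * -1 := by simp

/-- The element `w h(a)` of the big cell. -/
def wh (a : Fˣ) : SL F := ww * hh a

theorem wh_mul_wh (a b : Fˣ) : wh a * wh b = hh (-(b * a⁻¹)) := by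
  apply sl_ext <;> simp [wh, mul_apply, inv_neg, mul_comm]

theorem wh_mul_uu_mul_wh (a b x : Fˣ) :
    wh a * uu (x : F) * wh b = uu (-((a : F) ^ 2 * x)⁻¹) * wh (-(a * b * x)) *
      uu (-((b : F) ^ 2 * x)⁻¹) := by
  apply sl_ext <;> simp [wh, mul_apply, inv_neg] <;> field_simp
  all_goals ring

theorem bruhat (g : SL F) (c : Fˣ) (hc : g 1 0 = c) :
    g = uu (g 0 0 / c) * wh (-c) * uu (g 1 1 / c) := by
  have := sl_det g
  rw [hc] at this
  have h01 : g 0 1 = (g 0 0 * g 1 1 - 1) / c := by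
    field_simp; linear_combination -this
  apply sl_ext <;> simp [wh, mul_apply, inv_neg, hc, h01] <;> field_simp
  all_goals ring

theorem borel (g : SL F) (hc : g 1 0 = 0) : ∃ a : Fˣ, (a : F) = g 0 0 ∧
    g = hh a * uu (g 0 1 * g 1 1) := by
  have := sl_det g
  rw [hc, mul_zero, sub_zero] at this
  have h0 : g 0 0 ≠ 0 := left_ne_zero_of_mul_eq_one this
  have h1 : g 1 1 = (g 0 0)⁻¹ := eq_inv_of_mul_eq_one_right this
  refine ⟨Units.mk0 _ h0, rfl, ?_⟩
  apply sl_ext <;> simp [mul_apply, hc, h1]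
  field_simp

end Elements

section Algebra

variable {F : Type} [Field F] [Fintype F] {𝒜 : Type*} [Ring 𝒜] [Algebra ℂ 𝒜]

/-- The projector onto the `ψ(r·)`-eigenspace of the unipotent subgroup. -/
noncomputable def uProj (φ : SL F →* 𝒜) (ψ : AddChar F ℂ) (r : F) : 𝒜 :=
  isoProj (φ.comp uHom) (AddChar.mulShift ψ r).toMonoidHom

variable (φ : SL F →* 𝒜) (ψ : AddChar F ℂ)

theorem uProj_eq (r : F) :
    uProj φ ψ r = (Fintype.card F : ℂ)⁻¹ • ∑ x, ψ (-(r * x)) • φ (uu x) := by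
  rw [uProj, isoProj, Fintype.card_multiplicative]
  congr 1
  refine (Fintype.sum_equiv Multiplicative.ofAdd (fun x : F => ψ (-(r * x)) • φ (uu x)) _
    fun x => ?_).symm
  simp [uu, AddChar.mulShift_apply]

theorem uu_mul_uProj (x r : F) : φ (uu x) * uProj φ ψ r = ψ (r * x) • uProj φ ψ r :=
  mul_isoProj (φ.comp uHom) (AddChar.mulShift ψ r).toMonoidHom (Multiplicative.ofAdd x)

theorem uProj_mul_uu (x r : F) : uProj φ ψ r * φ (uu x) = ψ (r * x) • uProj φ ψ r :=
  isoProj_mul (φ.comp uHom) (AddChar.mulShift ψ r).toMonoidHom (Multiplicative.ofAdd x)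

theorem isIdempotentElem_uProj (r : F) : IsIdempotentElem (uProj φ ψ r) :=
  isIdempotentElem_isoProj _ _

theorem map_uProj {ℬ : Type*} [Ring ℬ] [Algebra ℂ ℬ] (f : 𝒜 →ₐ[ℂ] ℬ) (r : F) :
    f (uProj φ ψ r) = uProj ((f : 𝒜 →* ℬ).comp φ) ψ r :=
  map_isoProj f _ _

theorem uProj_mul_uProj_of_ne (hψ : ψ.IsPrimitive) {r s : F} (h : r ≠ s) :
    uProj φ ψ r * uProj φ ψ s = 0 := by
  have h1 : ∀ x, ψ (r * x) • (uProj φ ψ r * uProj φ ψ s) =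
      ψ (s * x) • (uProj φ ψ r * uProj φ ψ s) := by
    intro x
    rw [← smul_mul_assoc, ← uProj_mul_uu, mul_assoc, uu_mul_uProj, mul_smul_comm]
  by_contra hne
  have h2 : ∀ x, ψ ((r - s) * x) = 1 := by
    intro x
    have h3 := h1 x
    rw [← sub_eq_zero, ← sub_smul] at h3
    have h4 : ψ (r * x) = ψ (s * x) := sub_eq_zero.1 ((smul_eq_zero.1 h3).resolve_right hne)
    rw [sub_mul, sub_eq_add_neg, AddChar.map_add_eq_mul, h4, ← AddChar.map_add_eq_mul,
      add_neg_cancel, AddChar.map_zero_eq_one]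
  refine hψ (sub_ne_zero.2 h) (DFunLike.ext _ _ fun x => ?_)
  rw [AddChar.mulShift_apply, h2, AddChar.one_apply]

theorem sum_uProj [DecidableEq F] (hψ : ψ.IsPrimitive) : ∑ r, uProj φ ψ r = 1 := by
  simp_rw [uProj_eq, ← Finset.smul_sum]
  rw [Finset.sum_comm]
  simp_rw [← Finset.sum_smul]
  have : ∀ x : F, ∑ r, ψ (-(r * x)) = if x = 0 then (Fintype.card F : ℂ) else 0 := by
    intro x
    have := AddChar.sum_mulShift (-x) hψ
    simpa using this
  simp_rw [this, ite_smul, zero_smul]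
  rw [Finset.sum_ite_eq' Finset.univ (0 : F), if_pos (Finset.mem_univ _), smul_smul,
    inv_mul_cancel₀ (by simp), one_smul, uu_zero, map_one]

theorem hh_mul_uProj (a : Fˣ) (r : F) :
    φ (hh a) * uProj φ ψ r = uProj φ ψ (r * ((a : F) ^ 2)⁻¹) * φ (hh a) := by
  rw [uProj_eq, uProj_eq, mul_smul_comm, smul_mul_assoc, Finset.mul_sum, Finset.sum_mul]
  congr 1
  refine Fintype.sum_equiv (Equiv.mulLeft₀ ((a : F) ^ 2) (by simp)) _ _ fun x => ?_
  rw [mul_smul_comm, smul_mul_assoc, ← map_mul, ← map_mul, hh_mul_uu, Equiv.mulLeft₀_apply]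
  congr 3
  field_simp

theorem uProj_wh_uProj_wh_uProj (a b : Fˣ) (r s t : F) [DecidableEq F] :
    uProj φ ψ r * φ (wh a) * uProj φ ψ s * φ (wh b) * uProj φ ψ t =
      (Fintype.card F : ℂ)⁻¹ • (uProj φ ψ r * φ (hh (-(b * a⁻¹))) * uProj φ ψ t +
        ∑ x : Fˣ, ψ (-(s * x) - (r / a ^ 2 + t / b ^ 2) * (x : F)⁻¹) •
          (uProj φ ψ r * φ (wh (-(a * b * x))) * uProj φ ψ t)) := by
  rw [uProj_eq φ ψ s, mul_smul_comm, smul_mul_assoc, smul_mul_assoc, Finset.mul_sum,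
    Finset.sum_mul, Finset.sum_mul]
  congr 1
  rw [← Finset.add_sum_erase _ _ (Finset.mem_univ (0 : F))]
  congr 1
  · simp [mul_assoc, ← map_mul, wh_mul_wh]
  · refine (Finset.sum_bij (fun (x : Fˣ) _ => (x : F)) (by simp) (by simp [Units.ext_iff])
      (fun x hx => ⟨Units.mk0 x (by simpa using hx), by simp⟩) (fun x _ => ?_)).symm
    have h1 : uProj φ ψ r * φ (wh a) * (ψ (-(s * x)) • φ (uu (x : F))) * φ (wh b) * uProj φ ψ t =
        ψ (-(s * x)) • (uProj φ ψ r * φ (wh a * uu (x : F) * wh b) * uProj φ ψ t) := by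
      simp [mul_assoc]
    rw [h1, wh_mul_uu_mul_wh, map_mul, map_mul, ← mul_assoc, ← mul_assoc, uProj_mul_uu,
      mul_assoc _ (φ (uu _)), uu_mul_uProj, mul_smul_comm, smul_mul_assoc, smul_mul_assoc,
      smul_smul, smul_smul, ← AddChar.map_add_eq_mul, ← AddChar.map_add_eq_mul]
    congr 2
    field_simp
    ring

end Algebra

section Torus

variable {G : Type} [Group G] {V : Type} [AddCommGroup V] [Module ℂ V] [FiniteDimensional ℂ V]
  {ρ : Representation ℂ G V}

theorem exists_central_sign (hρ : ρ.IsIrreducible) {z : G} (hz2 : z * z = 1)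
    (hzc : ∀ g, z * g = g * z) : ∃ ε : ℂ, (ε = 1 ∨ ε = -1) ∧ ∀ v, ρ z v = ε • v := by
  have : Nontrivial V := ((isIrreducible_iff ρ).1 hρ).1
  obtain ⟨ε, hε⟩ := exists_eq_smul_of_commute hρ (ρ z) (fun g v => by
    rw [← Module.End.mul_apply, ← Module.End.mul_apply, ← map_mul, ← map_mul, hzc])
  refine ⟨ε, ?_, hε⟩
  obtain ⟨v, hv⟩ := exists_ne (0 : V)
  have h1 : (ε * ε) • v = (1 : ℂ) • v := by
    rw [mul_smul, ← hε, ← hε, ← Module.End.mul_apply, ← map_mul, hz2]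
    simp
  have h2 := smul_left_injective ℂ hv h1
  exact mul_self_eq_one_iff.1 h2

theorem exists_hom_eq_neg_one {A : Type} [CommGroup A] [Fintype A] {z : A} (hz1 : z ≠ 1)
    (hz2 : z * z = 1) : ∃ l : A →* ℂ, l z = -1 := by
  obtain ⟨l, hl⟩ := CommGroup.exists_apply_ne_one_of_hasEnoughRootsOfUnity A ℂ hz1
  refine ⟨(Units.coeHom ℂ).comp l, ?_⟩
  have h1 : ((l z : ℂˣ) : ℂ) * (l z : ℂˣ) = 1 := by
    rw [← Units.val_mul, ← map_mul, hz2, map_one, Units.val_one]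
  exact (mul_self_eq_one_iff.1 h1).resolve_left fun h => hl (Units.ext h)

theorem knutson_of_torus [Fintype G] (hρ : ρ.IsIrreducible) {A : Type} [CommGroup A] [Fintype A]
    (f : A →* G) {z : A} (hz1 : z ≠ 1) (hz2 : z * z = 1) (hzc : ∀ g, f z * g = g * f z)
    (h0 : ∀ a, a ≠ 1 → a ≠ z → ρ.character (f a) = 0) (hdim : finrank ℂ V ≤ Fintype.card A) :
    (2 * finrank ℂ V = Fintype.card A ∨ finrank ℂ V = Fintype.card A) ∧
      (KnutsonIndex G ρ.character = 1 ∨ KnutsonIndex G ρ.character = 2) := by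
  classical
  have hA : (Fintype.card A : ℂ) ≠ 0 := by simp
  have : Nontrivial V := ((isIrreducible_iff ρ).1 hρ).1
  have hpos : 0 < finrank ℂ V := finrank_pos
  obtain ⟨ε, hε, hρz⟩ := exists_central_sign hρ (by rw [← map_mul, hz2, map_one]) hzc
  obtain ⟨θ, hθ⟩ := exists_hom_eq_neg_one hz1 hz2
  have hzinv : z⁻¹ = z := inv_eq_of_mul_eq_one_left hz2
  have hχz : ρ.character (f z) = ε * finrank ℂ V := by
    have : ρ (f z) = ε • 1 := LinearMap.ext fun v => by simp [hρz]
    rw [Representation.character, this]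
    simp
  obtain ⟨l, hl⟩ : ∃ l : A →* ℂ, l z = ε := by
    rcases hε with rfl | rfl
    · exact ⟨1, rfl⟩
    · exact ⟨θ, hθ⟩
  obtain ⟨n, hn⟩ := exists_nat_trace_eq (isIdempotentElem_isoProj (MonoidHom.comp ρ f) l)
  rw [trace_isoProj, ← Finset.sum_subset (Finset.subset_univ {1, z}) (fun a _ ha => by
    simp only [Finset.mem_insert, Finset.mem_singleton, not_or] at ha
    rw [h0 a ha.1 ha.2, mul_zero]), Finset.sum_pair hz1.symm, hzinv, hχz, hl] at hn
  have hεε : ε * ε = 1 := by rcases hε with rfl | rfl <;> norm_num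
  rw [map_one, inv_one, map_one, char_one, ← mul_assoc, hεε, inv_mul_eq_iff_eq_mul₀ hA] at hn
  have hnat : 2 * finrank ℂ V = Fintype.card A * n := by
    have : (2 * finrank ℂ V : ℂ) = Fintype.card A * n := by rw [← hn]; ring
    exact_mod_cast this
  have hK : ρ.character * indFun f ((fun a => (1 : A →* ℂ) a⁻¹) + fun a => θ a⁻¹) =
      n • regChar G := by
    refine mul_indFun_eq_nsmul_regChar f _ _ (fun g h => char_conj ρ g h) (fun a ha => ?_) n ?_
    · by_cases haz : a = z
      · simp [haz, hθ]
      · rw [h0 a ha haz, zero_mul]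
    · rw [char_one]
      simp only [Pi.add_apply, inv_one, map_one]
      linear_combination -hn
  have hv : IsVirtualChar G (indFun f ((fun a => (1 : A →* ℂ) a⁻¹) + fun a => θ a⁻¹)) := by
    rw [indFun_add]
    exact Submodule.add_mem _ (isVirtualChar_indFun f 1) (isVirtualChar_indFun f θ)
  have hApos : 0 < Fintype.card A := Fintype.card_pos
  have hn0 : n ≠ 0 := by
    rintro rfl
    omega
  have hn2 : n ≤ 2 := by
    by_contra! h3
    nlinarith
  interval_cases n
  · exact absurd rfl hn0
  · exact ⟨Or.inl (by omega), Or.inl (knutsonIndex_eq_one hv hK)⟩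
  · exact ⟨Or.inr (by omega), knutsonIndex_eq_one_or_two hv hK⟩

end Torus

section Cuspidal

variable {F : Type} [Field F] [Fintype F]

section
variable {𝒜 : Type*} [Ring 𝒜] [Algebra ℂ 𝒜] (φ : SL F →* 𝒜) (ψ : AddChar F ℂ)

theorem uProj_hh_uProj_eq_zero (hψ : ψ.IsPrimitive) {a : Fˣ} {r s : F}
    (h : r ≠ s * ((a : F) ^ 2)⁻¹) : uProj φ ψ r * φ (hh a) * uProj φ ψ s = 0 := by
  rw [mul_assoc, hh_mul_uProj, ← mul_assoc, uProj_mul_uProj_of_ne φ ψ hψ h, zero_mul]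

theorem uProj_wh_commute (hψ : ψ.IsPrimitive) {c : F} (hc : c ≠ 0) (a b : Fˣ) :
    Commute (uProj φ ψ c * φ (wh a) * uProj φ ψ c) (uProj φ ψ c * φ (wh b) * uProj φ ψ c) := by
  classical
  have he := (isIdempotentElem_uProj φ ψ c).eq
  have key : ∀ a b : Fˣ,
      uProj φ ψ c * φ (wh a) * uProj φ ψ c * (uProj φ ψ c * φ (wh b) * uProj φ ψ c) =
      uProj φ ψ c * φ (wh a) * uProj φ ψ c * φ (wh b) * uProj φ ψ c := by
    intro a b
    simp only [mul_assoc]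
    rw [← mul_assoc (uProj φ ψ c) (uProj φ ψ c), he]
  rw [Commute, SemiconjBy, key, key, uProj_wh_uProj_wh_uProj, uProj_wh_uProj_wh_uProj]
  congr 2
  · by_cases hab : a ^ 2 = b ^ 2
    · congr 4
      have : (b * a⁻¹) * (b * a⁻¹) = 1 := by
        rw [mul_mul_mul_comm, ← sq, ← sq, inv_pow, hab, mul_inv_cancel]
      rw [← inv_eq_of_mul_eq_one_right this]
      simp
    · have aux : ∀ a b : Fˣ, a ^ 2 ≠ b ^ 2 → c ≠ c * (((-(b * a⁻¹) : Fˣ) : F) ^ 2)⁻¹ := by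
        intro a b hab h
        have h1 : (((-(b * a⁻¹) : Fˣ) : F) ^ 2)⁻¹ = 1 :=
          (mul_left_cancel₀ hc ((mul_one c).trans h)).symm
        apply hab
        have h2 : (-((b : F) * (a : F)⁻¹)) ^ 2 = 1 := by
          simpa using inv_eq_one.1 h1
        ext
        push_cast
        field_simp at h2
        linear_combination -h2
      rw [uProj_hh_uProj_eq_zero φ ψ hψ (aux a b hab),
        uProj_hh_uProj_eq_zero φ ψ hψ (aux b a (Ne.symm hab))]
  · refine Finset.sum_congr rfl fun x _ => ?_
    rw [mul_comm a b, add_comm (c / (a : F) ^ 2)]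

theorem uProj_conj_cases (hψ : ψ.IsPrimitive) {c : F} (hc : c ≠ 0) (g : SL F) :
    (∃ (k : ℂ) (a : Fˣ), a * a = 1 ∧ uProj φ ψ c * φ g * uProj φ ψ c =
      k • (uProj φ ψ c * φ (hh a) * uProj φ ψ c)) ∨
    (∃ (k : ℂ) (a : Fˣ), uProj φ ψ c * φ g * uProj φ ψ c =
      k • (uProj φ ψ c * φ (wh a) * uProj φ ψ c)) := by
  by_cases hg : g 1 0 = 0
  · left
    obtain ⟨a, -, h⟩ := borel g hg
    have h1 : uProj φ ψ c * φ g * uProj φ ψ c = ψ (c * (g 0 1 * g 1 1)) •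
        (uProj φ ψ c * φ (hh a) * uProj φ ψ c) := by
      conv_lhs => rw [h]
      rw [map_mul, ← mul_assoc, mul_assoc _ (φ (uu _)), uu_mul_uProj, mul_smul_comm]
    by_cases ha : a * a = 1
    · exact ⟨_, a, ha, h1⟩
    · refine ⟨0, 1, one_mul 1, ?_⟩
      rw [h1, uProj_hh_uProj_eq_zero φ ψ hψ, smul_zero, zero_smul]
      intro h2
      have h3 : ((a : F) ^ 2)⁻¹ = 1 := (mul_left_cancel₀ hc ((mul_one c).trans h2)).symm
      apply ha
      ext
      simpa [sq] using inv_eq_one.1 h3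
  · right
    have h := bruhat g (Units.mk0 _ hg) rfl
    refine ⟨ψ (c * (g 0 0 / (Units.mk0 _ hg : Fˣ))) * ψ (c * (g 1 1 / (Units.mk0 _ hg : Fˣ))),
      -(Units.mk0 _ hg), ?_⟩
    conv_lhs => rw [h]
    rw [map_mul, map_mul, ← mul_assoc, ← mul_assoc, uProj_mul_uu, mul_assoc _ (φ (uu _)),
      uu_mul_uProj]
    simp only [smul_mul_assoc, mul_smul_comm, smul_smul]
    rw [mul_comm (ψ _)]

end

omit [Fintype F] in
theorem hh_central {a : Fˣ} (ha : a * a = 1) (g : SL F) : hh a * g = g * hh a := by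
  have ha' : (a : F)⁻¹ = a := by
    have : a⁻¹ = a := inv_eq_of_mul_eq_one_left ha
    rw [← Units.val_inv_eq_inv_val, this]
  apply sl_ext <;> simp [mul_apply, ha', mul_comm]

variable {V : Type} [AddCommGroup V] [Module ℂ V] [FiniteDimensional ℂ V]
  {ρ : Representation ℂ (SL F) V} {ψ : AddChar F ℂ}

theorem finrank_range_uProj_le_one (hρ : ρ.IsIrreducible) (hψ : ψ.IsPrimitive) {c : F}
    (hc : c ≠ 0) : finrank ℂ (LinearMap.range (uProj ρ ψ c)) ≤ 1 := by
  have hcentral : ∀ {a : Fˣ}, a * a = 1 → ∀ g, Commute (uProj ρ ψ c * ρ (hh a) * uProj ρ ψ c)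
      (uProj ρ ψ c * ρ g * uProj ρ ψ c) := by
    intro a ha g
    have h1 : ∀ g, Commute (ρ (hh a)) (ρ g) := fun g => by
      rw [Commute, SemiconjBy, ← map_mul, ← map_mul, hh_central ha]
    have h2 : Commute (ρ (hh a)) (uProj ρ ψ c) := by
      rw [uProj_eq]
      exact (Commute.sum_right _ _ _ fun x _ => (h1 _).smul_right _).smul_right _
    have h3 : uProj ρ ψ c * ρ (hh a) * uProj ρ ψ c = ρ (hh a) * uProj ρ ψ c := by
      rw [← h2.eq, mul_assoc, (isIdempotentElem_uProj _ ψ c).eq]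
    rw [h3]
    refine ((h2.mul_right (h1 g)).mul_right h2).mul_left ?_
    have he := (isIdempotentElem_uProj ρ ψ c).eq
    rw [Commute, SemiconjBy, ← mul_assoc, ← mul_assoc, he, mul_assoc (_ * ρ g), he]
  refine finrank_range_le_one hρ (isIdempotentElem_uProj _ _ _) fun g h => ?_
  rcases uProj_conj_cases ρ ψ hψ hc g with ⟨k, a, ha, hk⟩ | ⟨k, a, hk⟩
  · rw [hk]
    exact (hcentral ha h).smul_left k
  · rcases uProj_conj_cases ρ ψ hψ hc h with ⟨k', b, hb, hk'⟩ | ⟨k', b, hk'⟩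
    · rw [hk']
      exact ((hcentral hb g).smul_left k').symm
    · rw [hk, hk']
      exact ((uProj_wh_commute ρ ψ hψ hc a b).smul_right k').smul_left k

theorem finrank_eq_sum_uProj (ρ : Representation ℂ (SL F) V) (hψ : ψ.IsPrimitive) :
    finrank ℂ V = ∑ r, finrank ℂ (LinearMap.range (uProj ρ ψ r)) := by
  classical
  have h := congrArg (LinearMap.trace ℂ V) (sum_uProj ρ ψ hψ)
  rw [map_sum, LinearMap.trace_one] at h
  simp_rw [trace_eq_finrank_range (isIdempotentElem_uProj ρ ψ _)] at h
  exact_mod_cast h.symm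

theorem finrank_le_of_uProj_zero (hρ : ρ.IsIrreducible) (hψ : ψ.IsPrimitive)
    (h0 : uProj ρ ψ 0 = 0) : finrank ℂ V ≤ Fintype.card F - 1 := by
  classical
  rw [finrank_eq_sum_uProj ρ hψ, ← Finset.add_sum_erase _ _ (Finset.mem_univ (0 : F)), h0,
    LinearMap.range_zero, finrank_bot, zero_add]
  refine (Finset.sum_le_card_nsmul _ _ 1 fun c hc =>
    finrank_range_uProj_le_one hρ hψ (Finset.ne_of_mem_erase hc)).trans ?_
  simp [Finset.card_erase_of_mem]

omit [FiniteDimensional ℂ V] in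
theorem character_hh (ρ : Representation ℂ (SL F) V) (hψ : ψ.IsPrimitive) {a : Fˣ}
    (ha : a * a ≠ 1) :
    ρ.character (hh a) = LinearMap.trace ℂ V (ρ (hh a) * uProj ρ ψ 0) := by
  classical
  have h1 : ρ (hh a) = ∑ r, ρ (hh a) * uProj ρ ψ r := by
    rw [← Finset.mul_sum, sum_uProj ρ ψ hψ, mul_one]
  rw [Representation.character, h1, map_sum, ← h1]
  refine Finset.sum_eq_single 0 (fun r _ hr => ?_) (by simp)
  rw [← (isIdempotentElem_uProj ρ ψ r).eq, ← mul_assoc, LinearMap.trace_mul_comm, ← mul_assoc,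
    uProj_hh_uProj_eq_zero ρ ψ hψ, map_zero]
  intro h
  have h3 : ((a : F) ^ 2)⁻¹ = 1 := (mul_left_cancel₀ hr ((mul_one r).trans h)).symm
  apply ha
  ext
  simpa [sq] using inv_eq_one.1 h3

omit [Fintype F] in
theorem neg_one_units_ne_one (h2 : (2 : F) ≠ 0) : (-1 : Fˣ) ≠ 1 := by
  intro h
  have h1 : (-1 : F) = 1 := by simpa using congrArg Units.val h
  exact h2 (by linear_combination -h1)

theorem card_units_eq : Fintype.card F - 1 = Nat.card Fˣ := by
  rw [Nat.card_units, Nat.card_eq_fintype_card]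

theorem knutson_cuspidal [Fintype (SL F)] (hρ : ρ.IsIrreducible) (h2 : (2 : F) ≠ 0)
    (hψ : ψ.IsPrimitive) (h0 : uProj ρ ψ 0 = 0) :
    (2 * finrank ℂ V = Fintype.card F - 1 ∨ finrank ℂ V = Fintype.card F - 1) ∧
      (KnutsonIndex (SL F) ρ.character = 1 ∨ KnutsonIndex (SL F) ρ.character = 2) := by
  classical
  have hle := finrank_le_of_uProj_zero hρ hψ h0
  rw [card_units_eq, Nat.card_eq_fintype_card] at hle ⊢
  refine knutson_of_torus hρ hh (neg_one_units_ne_one h2) (by simp)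
    (hh_central (by simp)) (fun a ha ha' => ?_) hle
  rw [character_hh ρ hψ, h0, mul_zero, map_zero]
  intro h
  rcases mul_self_eq_one_iff.1 (congrArg Units.val h) with h | h
  · exact ha (Units.ext h)
  · exact ha' (Units.ext (by simpa using h))

end Cuspidal

theorem mul_eq_self_of_isoProj_mul_eq_zero {A : Type} [CommGroup A] [Fintype A] {𝒜 : Type*}
    [Ring 𝒜] [Algebra ℂ 𝒜] (φ : A →* 𝒜) {x : 𝒜}
    (h : ∀ l : A →* ℂ, l ≠ 1 → isoProj φ l * x = 0) (a : A) : φ a * x = x := by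
  classical
  let L : AddChar (Additive A) ℂ → A →* ℂ := fun θ =>
    { toFun := fun a => θ (Additive.ofMul a)
      map_one' := θ.map_zero_eq_one
      map_mul' := fun a b => θ.map_add_eq_mul _ _ }
  have hsum : ∑ θ, isoProj φ (L θ) = 1 := by
    have h1 : ∀ a : A, ∑ θ, L θ a⁻¹ = if a = 1 then (Fintype.card A : ℂ) else 0 := by
      intro a
      have := AddChar.sum_apply_eq_ite (Additive.ofMul a⁻¹)
      simpa [L] using this
    simp_rw [isoProj, ← Finset.smul_sum]
    rw [Finset.sum_comm]
    simp_rw [← Finset.sum_smul, h1, ite_smul, zero_smul]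
    rw [Finset.sum_ite_eq' Finset.univ (1 : A), if_pos (Finset.mem_univ _), smul_smul,
      inv_mul_cancel₀ (by simp), one_smul, map_one]
  have h2 : isoProj φ 1 * x = x := by
    conv_rhs => rw [← one_mul x, ← hsum, Finset.sum_mul]
    rw [Finset.sum_eq_single (0 : AddChar (Additive A) ℂ)]
    · congr 2
    · intro θ _ hθ
      refine h _ fun h1 => hθ (DFunLike.ext _ _ fun a => ?_)
      exact DFunLike.congr_fun h1 (Additive.toMul a)
    · simp
  rw [← h2, ← mul_assoc, mul_isoProj, MonoidHom.one_apply, one_smul]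

section Principal

variable {F : Type} [Field F] [Fintype F] {V : Type} [AddCommGroup V] [Module ℂ V]
  {ρ : Representation ℂ (SL F) V} {ψ : AddChar F ℂ} {v : V}

theorem rho_uu_eq (hv : uProj ρ ψ 0 v = v) (x : F) : ρ (uu x) v = v := by
  have h := LinearMap.congr_fun (uu_mul_uProj ρ ψ x 0) v
  simpa [hv] using h

theorem uProj_rho_uu_mul (x : F) (g : SL F) (w : V) :
    uProj ρ ψ 0 (ρ (uu x * g) w) = uProj ρ ψ 0 (ρ g w) := by
  have h := LinearMap.congr_fun (uProj_mul_uu ρ ψ x 0) (ρ g w)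
  simpa using h

theorem rho_borel (hv : uProj ρ ψ 0 v = v) {α : Fˣ →* ℂ} (hα : ∀ a, ρ (hh a) v = α a • v)
    {g : SL F} (hg : g 1 0 = 0) : ∃ a : Fˣ, (a : F) = g 0 0 ∧ ρ g v = α a • v := by
  obtain ⟨a, ha, h⟩ := borel g hg
  refine ⟨a, ha, ?_⟩
  rw [h, map_mul, Module.End.mul_apply, rho_uu_eq hv, hα]

theorem rho_bruhat (hv : uProj ρ ψ 0 v = v) {α : Fˣ →* ℂ} (hα : ∀ a, ρ (hh a) v = α a • v)
    {g : SL F} {c : Fˣ} (hg : g 1 0 = c) :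
    ρ g v = α (-c) • ρ (uu (g 0 0 / c)) (ρ ww v) := by
  conv_lhs => rw [bruhat g c hg, wh]
  simp only [map_mul, Module.End.mul_apply, rho_uu_eq hv, hα, map_smul]

theorem uProj_rho_bruhat (hv : uProj ρ ψ 0 v = v) {α : Fˣ →* ℂ}
    (hα : ∀ a, ρ (hh a) v = α a • v) {g : SL F} {c : Fˣ} (hg : g 1 0 = c) :
    uProj ρ ψ 0 (ρ g v) = α (-c) • uProj ρ ψ 0 (ρ ww v) := by
  rw [rho_bruhat hv hα hg, map_smul, ← Module.End.mul_apply (ρ _), ← map_mul, uProj_rho_uu_mul]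

theorem finrank_le_card_add_one (hρ : ρ.IsIrreducible) (hv0 : v ≠ 0) (hv : uProj ρ ψ 0 v = v)
    {α : Fˣ →* ℂ} (hα : ∀ a, ρ (hh a) v = α a • v) : finrank ℂ V ≤ Fintype.card F + 1 := by
  let b : Option F → V := fun o => o.elim v fun x => ρ (uu x) (ρ ww v)
  have htop : Submodule.span ℂ (Set.range b) = ⊤ := by
    rw [eq_top_iff, ← span_orbit_eq_top hρ hv0, Submodule.span_le]
    rintro _ ⟨g, rfl⟩
    by_cases hg : g 1 0 = 0
    · obtain ⟨a, -, h⟩ := rho_borel hv hα hg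
      simp only [h]
      exact Submodule.smul_mem _ _ (Submodule.subset_span ⟨none, rfl⟩)
    · have h := rho_bruhat hv hα (g := g) (c := Units.mk0 _ hg) rfl
      simp only [h]
      exact Submodule.smul_mem _ _ (Submodule.subset_span ⟨some _, rfl⟩)
  have h := finrank_range_le_card (R := ℂ) b
  rwa [Set.finrank, htop, finrank_top, Fintype.card_option] at h

theorem range_uProj_le (hρ : ρ.IsIrreducible) (hv0 : v ≠ 0) (hv : uProj ρ ψ 0 v = v)
    {α : Fˣ →* ℂ} (hα : ∀ a, ρ (hh a) v = α a • v) :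
    LinearMap.range (uProj ρ ψ 0) ≤ Submodule.span ℂ {v, uProj ρ ψ 0 (ρ ww v)} := by
  rintro _ ⟨x, rfl⟩
  have hx : x ∈ Submodule.span ℂ (Set.range fun g => ρ g v) := by
    rw [span_orbit_eq_top hρ hv0]; exact Submodule.mem_top
  suffices h : Submodule.span ℂ (Set.range fun g => ρ g v) ≤
      (Submodule.span ℂ {v, uProj ρ ψ 0 (ρ ww v)}).comap (uProj ρ ψ 0) from h hx
  rw [Submodule.span_le]
  rintro _ ⟨g, rfl⟩
  simp only [Submodule.comap_coe, Set.mem_preimage, SetLike.mem_coe]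
  by_cases hg : g 1 0 = 0
  · obtain ⟨a, -, h⟩ := rho_borel hv hα hg
    rw [h, map_smul, hv]
    exact Submodule.smul_mem _ _ (Submodule.subset_span (by simp))
  · rw [uProj_rho_bruhat hv hα (c := Units.mk0 _ hg) rfl]
    exact Submodule.smul_mem _ _ (Submodule.subset_span (by simp))

end Principal

section NonsplitTorus

variable {F : Type} [Field F]

theorem ringChar_ne_two (h2 : (2 : F) ≠ 0) : ringChar F ≠ 2 := by
  intro h
  have := CharP.cast_eq_zero F (ringChar F)
  rw [h] at this
  exact h2 (by exact_mod_cast this)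

/-- The norm-one torus of `F(√δ)`. -/
def nsTorus (δ : F) : Subgroup (SL F) where
  carrier := {g | g 0 0 = g 1 1 ∧ g 0 1 = δ * g 1 0}
  one_mem' := by simp
  mul_mem' := by
    rintro g h ⟨h1, h2⟩ ⟨h3, h4⟩
    simp only [Set.mem_ofPred_eq, mul_apply, h1, h2, h3, h4]
    constructor <;> ring
  inv_mem' := by
    rintro g ⟨h1, h2⟩
    simp [inv_00, inv_01, inv_10, inv_11, h1, h2]

theorem mem_nsTorus {δ : F} {g : SL F} :
    g ∈ nsTorus δ ↔ g 0 0 = g 1 1 ∧ g 0 1 = δ * g 1 0 := Iff.rfl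

instance (δ : F) : CommGroup (nsTorus δ) :=
  { (inferInstance : Group (nsTorus δ)) with
    mul_comm := by
      rintro ⟨g, h1, h2⟩ ⟨h, h3, h4⟩
      apply Subtype.ext
      apply sl_ext <;> simp only [Subgroup.coe_mul, mul_apply, h1, h2, h3, h4] <;> ring }

theorem sq_sub_ne_zero {δ : F} (hδ : ¬ IsSquare δ) {m n : F} (h : m ≠ 0 ∨ n ≠ 0) :
    m ^ 2 - δ * n ^ 2 ≠ 0 := by
  intro h0
  by_cases hn : n = 0
  · subst hn
    simp at h h0
    exact h h0
  · refine hδ ⟨m / n, ?_⟩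
    field_simp
    linear_combination -h0

theorem card_nsTorus [Fintype F] {δ : F} (hδ : ¬ IsSquare δ) (h2 : (2 : F) ≠ 0) :
    Nat.card (nsTorus δ) = Fintype.card F + 1 := by
  have hne : ∀ t : F, 1 - δ * t ^ 2 ≠ 0 := fun t => by
    simpa using sq_sub_ne_zero hδ (m := 1) (n := t) (Or.inl one_ne_zero)
  let f : Option F → nsTorus δ := fun o => o.elim ⟨-1, by simp [mem_nsTorus]⟩ fun t =>
    ⟨mk ((1 + δ * t ^ 2) / (1 - δ * t ^ 2)) (δ * (2 * t / (1 - δ * t ^ 2)))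
      (2 * t / (1 - δ * t ^ 2)) ((1 + δ * t ^ 2) / (1 - δ * t ^ 2))
      (by have := hne t; field_simp; ring), by simp [mem_nsTorus]⟩
  have hf : Function.Bijective f := by
    constructor
    · have h1 : ∀ t, f (some t) ≠ f none := by
        intro t h
        have := congrArg (fun g : nsTorus δ => (g : SL F) 0 0) h
        have h3 := hne t
        simp [f] at this
        field_simp at this
        exact h2 (by linear_combination this)
      rintro (_ | t) (_ | s) h
      · rfl
      · exact absurd h.symm (h1 s)
      · exact absurd h (h1 t)
      · have e1 := congrArg (fun g : nsTorus δ => (g : SL F) 0 0) h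
        have e2 := congrArg (fun g : nsTorus δ => (g : SL F) 1 0) h
        have h3 := hne t
        have h4 := hne s
        simp [f] at e1 e2
        have e3 : (1 + δ * t ^ 2) / (1 - δ * t ^ 2) + 1 = 2 / (1 - δ * t ^ 2) := by
          field_simp; ring
        have e4 : (1 + δ * s ^ 2) / (1 - δ * s ^ 2) + 1 = 2 / (1 - δ * s ^ 2) := by
          field_simp; ring
        rw [← e1, e3] at e4
        have e5 : 2 * t / (1 - δ * t ^ 2) = t * (2 / (1 - δ * t ^ 2)) := by ring
        have e6 : 2 * s / (1 - δ * s ^ 2) = s * (2 / (1 - δ * t ^ 2)) := by rw [e4]; ring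
        rw [e5, e6] at e2
        rw [mul_right_cancel₀ (div_ne_zero h2 h3) e2]
    · rintro ⟨g, hg1, hg2⟩
      have hdet := sl_det g
      rw [hg2, ← hg1] at hdet
      by_cases h : g 0 0 + 1 = 0
      · refine ⟨none, Subtype.ext ?_⟩
        have h00 : g 0 0 = -1 := by linear_combination h
        have h10 : g 1 0 = 0 := by
          by_contra h10
          refine sq_sub_ne_zero hδ (m := 0) (n := g 1 0) (Or.inr h10) ?_
          linear_combination hdet - (g 0 0 - 1) * h
        apply sl_ext <;> simp [f, ← hg1, hg2, h00, h10]
      · refine ⟨some (g 1 0 / (g 0 0 + 1)), Subtype.ext ?_⟩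
        have e1 : 1 - δ * (g 1 0 / (g 0 0 + 1)) ^ 2 = 2 / (g 0 0 + 1) := by
          field_simp; linear_combination hdet
        have e2 : 1 + δ * (g 1 0 / (g 0 0 + 1)) ^ 2 = 2 * g 0 0 / (g 0 0 + 1) := by
          field_simp; linear_combination -hdet
        apply sl_ext <;> simp only [f, Option.elim, mk_00, mk_01, mk_10, mk_11, e1, e2, ← hg1, hg2]
          <;> field_simp
  rw [← Nat.card_congr (Equiv.ofBijective f hf), Nat.card_eq_fintype_card, Fintype.card_option]

theorem exists_sq_sub_eq [Fintype F] (h2 : (2 : F) ≠ 0) {δ : F} (hδ : δ ≠ 0) (c : F) :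
    ∃ m n : F, m ^ 2 - δ * n ^ 2 = c := by
  have hodd : Fintype.card F % 2 = 1 := FiniteField.odd_card_of_char_ne_two (ringChar_ne_two h2)
  obtain ⟨m, n, h⟩ := FiniteField.exists_root_sum_quadratic (R := F)
    (f := Polynomial.X ^ 2) (g := Polynomial.C (-δ) * Polynomial.X ^ 2 + Polynomial.C 0 *
      Polynomial.X + Polynomial.C (-c)) (Polynomial.degree_X_pow 2)
    (Polynomial.degree_quadratic (neg_ne_zero.2 hδ)) hodd
  refine ⟨m, n, ?_⟩
  simp at h
  linear_combination h

theorem conj_10 (h g : SL F) {δ : F} (hg : g ∈ nsTorus δ) :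
    (h * g * h⁻¹) 1 0 = g 1 0 * (h 1 1 ^ 2 - δ * h 1 0 ^ 2) := by
  simp only [mul_apply, inv_00, inv_10, hg.1, hg.2]
  ring

end NonsplitTorus

section Norm

variable {F : Type} [Field F] [Fintype F]

/-- The norm of the bottom row of `h` in `F(√δ)`. -/
def rowNorm {δ : F} (hδ : ¬ IsSquare δ) (h : SL F) : Fˣ :=
  Units.mk0 (h 1 1 ^ 2 - δ * h 1 0 ^ 2) (sq_sub_ne_zero hδ (by
    by_contra! h0
    have := sl_det h
    rw [h0.1, h0.2] at this
    simp at this))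

theorem sum_rowNorm [Fintype (SL F)] (h2 : (2 : F) ≠ 0) {δ : F} (hδ : ¬ IsSquare δ)
    {α : Fˣ →* ℂ} (hα : α ≠ 1) : ∑ h, α (rowNorm hδ h) = 0 := by
  obtain ⟨l, hl⟩ : ∃ l, α l ≠ 1 := by
    by_contra! h
    exact hα (MonoidHom.ext h)
  have hδ0 : δ ≠ 0 := by rintro rfl; exact hδ ⟨0, by simp⟩
  obtain ⟨m, n, hmn⟩ := exists_sq_sub_eq h2 hδ0 (l : F)
  have hl0 : (l : F) ≠ 0 := l.ne_zero
  let T : SL F → SL F := fun h =>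
    mk ((h 0 0 * m + h 0 1 * n) / l) ((h 0 0 * (δ * n) + h 0 1 * m) / l)
      (h 1 0 * m + h 1 1 * n) (h 1 0 * (δ * n) + h 1 1 * m) (by
        have := sl_det h
        field_simp
        linear_combination (m ^ 2 - δ * n ^ 2) * this + hmn)
  have hT : Function.Bijective T := by
    refine Finite.injective_iff_bijective.1 fun g h hgh => ?_
    have e00 := congrArg (fun x : SL F => x 0 0) hgh
    have e01 := congrArg (fun x : SL F => x 0 1) hgh
    have e10 := congrArg (fun x : SL F => x 1 0) hgh
    have e11 := congrArg (fun x : SL F => x 1 1) hgh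
    simp only [T, mk_00, mk_01, mk_10, mk_11, div_left_inj' hl0] at e00 e01 e10 e11
    apply sl_ext <;> refine mul_left_cancel₀ hl0 ?_ <;> rw [← hmn]
    · linear_combination m * e00 - n * e01
    · linear_combination m * e01 - δ * n * e00
    · linear_combination m * e10 - n * e11
    · linear_combination m * e11 - δ * n * e10
  have hN : ∀ h, rowNorm hδ (T h) = l * rowNorm hδ h := by
    intro h
    ext
    simp only [rowNorm, T, Units.val_mk0, Units.val_mul, mk_10, mk_11, ← hmn]
    ring
  have h1 : ∑ h, α (rowNorm hδ h) = α l * ∑ h, α (rowNorm hδ h) := by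
    conv_lhs => rw [← hT.sum_comp]
    simp_rw [hN, map_mul, Finset.mul_sum]
  have h3 : (α l - 1) * ∑ h, α (rowNorm hδ h) = 0 := by linear_combination -h1
  exact (mul_eq_zero.1 h3).resolve_left (sub_ne_zero.2 hl)

end Norm

section Cases

variable {F : Type} [Field F] [Fintype F] {V : Type} [AddCommGroup V] [Module ℂ V]
  [FiniteDimensional ℂ V] {ρ : Representation ℂ (SL F) V} {ψ : AddChar F ℂ} {v : V}

theorem knutson_principal [Fintype (SL F)] (hρ : ρ.IsIrreducible) (h2 : (2 : F) ≠ 0)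
    (hv0 : v ≠ 0) (hv : uProj ρ ψ 0 v = v) {α : Fˣ →* ℂ} (hα : ∀ a, ρ (hh a) v = α a • v)
    (hα1 : α ≠ 1) :
    (2 * finrank ℂ V = Fintype.card F + 1 ∨ finrank ℂ V = Fintype.card F + 1) ∧
      (KnutsonIndex (SL F) ρ.character = 1 ∨ KnutsonIndex (SL F) ρ.character = 2) := by
  classical
  obtain ⟨δ, hδ⟩ := FiniteField.exists_nonsquare (ringChar_ne_two h2)
  have : Fintype (nsTorus δ) := Fintype.ofFinite _
  have hcard : Fintype.card (nsTorus δ) = Fintype.card F + 1 := by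
    rw [← Nat.card_eq_fintype_card, card_nsTorus hδ h2]
  rw [← hcard]
  have hz : (-1 : SL F) ∈ nsTorus δ := by simp [mem_nsTorus]
  refine knutson_of_torus hρ (nsTorus δ).subtype (z := ⟨-1, hz⟩) ?_ ?_ ?_ ?_ ?_
  · intro h
    have h1 := congrArg (fun g : nsTorus δ => (g : SL F) 0 0) h
    exact h2 (by simp at h1; linear_combination -h1)
  · apply Subtype.ext
    simp
  · intro g
    exact neg_one_comm g
  · rintro ⟨g, hg⟩ hg1 hgz
    have hg0 : g 1 0 ≠ 0 := by
      intro h0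
      have hd := sl_det g
      rw [h0, mul_zero, sub_zero, ← hg.1] at hd
      rcases mul_self_eq_one_iff.1 hd with h | h
      · apply hg1
        apply Subtype.ext
        apply sl_ext <;> simp [hg.2, ← hg.1, h0, h]
      · apply hgz
        apply Subtype.ext
        apply sl_ext <;> simp [hg.2, ← hg.1, h0, h]
    refine character_eq_zero_of_sum_conj hρ (uProj ρ ψ 0) (v := v) (by rwa [hv]) ?_
    have h1 : ∀ h, uProj ρ ψ 0 (ρ (h * g * h⁻¹) v) =
        α (rowNorm hδ h) • α (-Units.mk0 _ hg0) • uProj ρ ψ 0 (ρ ww v) := by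
      intro h
      rw [uProj_rho_bruhat hv hα (c := Units.mk0 _ hg0 * rowNorm hδ h) (conj_10 h g hg), smul_smul,
        ← map_mul]
      congr 2
      rw [mul_neg, mul_comm]
    simp only [Subgroup.subtype_apply, map_sum, h1]
    rw [← Finset.sum_smul, sum_rowNorm h2 hδ hα1, zero_smul]
  · rw [hcard]
    exact finrank_le_card_add_one hρ hv0 hv hα

theorem knutson_trivial {G : Type} [Group G] [Fintype G] {χ : G → ℂ} (hχ : ∀ g, χ g = 1) :
    KnutsonIndex G χ = 1 := by
  refine knutsonIndex_eq_one (isVirtualChar_indFun (1 : Unit →* G) 1) ?_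
  refine mul_indFun_eq_nsmul_regChar _ _ χ (fun g h => by rw [hχ, hχ]) (fun a ha => ?_) 1 ?_
  · exact absurd (Subsingleton.elim _ _) ha
  · simp [hχ]

theorem knutson_steinberg [Fintype (SL F)] (hρ : ρ.IsIrreducible)
    (hv0 : v ≠ 0) (hv : uProj ρ ψ 0 v = v) (hα : ∀ a, ρ (hh a) v = v) :
    (finrank ℂ V = 1 ∨ finrank ℂ V = Fintype.card F) ∧ KnutsonIndex (SL F) ρ.character = 1 := by
  classical
  have hα' : ∀ a, ρ (hh a) v = (1 : Fˣ →* ℂ) a • v := fun a => by simp [hα]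
  by_cases hs : ∑ g, ρ g v = 0
  · set E := uProj ρ ψ 0 with hE
    have hterm : ∀ g : SL F, E (ρ g v) = if g 1 0 = 0 then v else E (ρ ww v) := by
      intro g
      split_ifs with hg
      · obtain ⟨a, -, h⟩ := rho_borel hv hα' hg
        rw [h, map_smul, hv, MonoidHom.one_apply, one_smul]
      · rw [uProj_rho_bruhat hv hα' (c := Units.mk0 _ hg) rfl, MonoidHom.one_apply, one_smul]
    have hsum : ∑ g : SL F, (if g 1 0 = 0 then v else E (ρ ww v)) = 0 := by
      simp_rw [← hterm]
      rw [← map_sum, hs, map_zero]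
    have hχ : ∀ x : F, x ≠ 0 → ρ.character (uu x) = 0 := by
      intro x hx
      refine character_eq_zero_of_sum_conj hρ E (v := v) (by rwa [hv]) ?_
      rw [map_sum, ← hsum]
      refine Finset.sum_congr rfl fun g _ => ?_
      rw [hterm]
      have : (g * uu x * g⁻¹) 1 0 = -x * (g 1 0) ^ 2 := by
        simp only [mul_apply, inv_00, inv_10, uu_00, uu_01, uu_10, uu_11]
        ring
      rw [this]
      congr 1
      simp [hx]
    have hmem : E (ρ ww v) ∈ Submodule.span ℂ {v} := by
      rw [Finset.sum_ite, Finset.sum_const, Finset.sum_const, ← Nat.cast_smul_eq_nsmul ℂ,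
        ← Nat.cast_smul_eq_nsmul ℂ, add_eq_zero_iff_eq_neg'] at hsum
      have hne : ((Finset.univ.filter fun g : SL F => ¬ g 1 0 = 0).card : ℂ) ≠ 0 := by
        rw [Nat.cast_ne_zero, Finset.card_ne_zero]
        exact ⟨ww, by simp⟩
      rw [← inv_smul_smul₀ hne (E (ρ ww v)), hsum]
      exact Submodule.smul_mem _ _ (Submodule.neg_mem _ (Submodule.smul_mem _ _
        (Submodule.mem_span_singleton_self v)))
    have hrange : LinearMap.range E = Submodule.span ℂ {v} := by
      refine le_antisymm ((range_uProj_le hρ hv0 hv hα').trans ?_) ?_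
      · rw [Submodule.span_le, Set.insert_subset_iff, Set.singleton_subset_iff]
        exact ⟨Submodule.mem_span_singleton_self v, hmem⟩
      · rw [Submodule.span_singleton_le_iff_mem]
        exact ⟨v, hv⟩
    have htr : LinearMap.trace ℂ V E = 1 := by
      rw [trace_eq_finrank_range (isIdempotentElem_uProj ρ ψ 0), ← hE, hrange,
        finrank_span_singleton hv0, Nat.cast_one]
    have hχ' : ∀ a : Multiplicative F, a ≠ 1 → ρ.character (uHom a) = 0 := fun a ha => hχ a.toAdd ha
    have hq : (Fintype.card F : ℂ) ≠ 0 := by simp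
    have hdim : (finrank ℂ V : ℂ) = Fintype.card F := by
      rw [hE, uProj, trace_isoProj, Finset.sum_eq_single 1
        (fun a _ ha => by rw [hχ' a ha, mul_zero]) (by simp), Fintype.card_multiplicative,
        inv_mul_eq_iff_eq_mul₀ hq, map_one, char_one] at htr
      simpa using htr
    refine ⟨Or.inr (by exact_mod_cast hdim), knutsonIndex_eq_one (isVirtualChar_indFun uHom 1) ?_⟩
    refine mul_indFun_eq_nsmul_regChar _ _ _ (fun g h => char_conj ρ g h)
      (fun a ha => by rw [hχ' a ha, zero_mul]) 1 ?_
    rw [char_one, hdim]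
    simp
  · have hinv : ∀ g, ρ g (∑ g, ρ g v) = ∑ g, ρ g v := by
      intro g
      rw [map_sum]
      refine Fintype.sum_equiv (Equiv.mulLeft g) _ _ fun h => ?_
      rw [Equiv.coe_mulLeft, map_mul, Module.End.mul_apply]
    have htop : Submodule.span ℂ {∑ g, ρ g v} = ⊤ := by
      refine eq_top_of_irreducible hρ (fun g w hw => ?_) (Submodule.mem_span_singleton_self _) hs
      obtain ⟨c, rfl⟩ := Submodule.mem_span_singleton.1 hw
      rw [map_smul, hinv]
      exact hw
    have hone : ∀ g, ρ g = 1 := by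
      intro g
      ext w
      obtain ⟨c, rfl⟩ := Submodule.mem_span_singleton.1 (htop ▸ Submodule.mem_top : w ∈ _)
      rw [map_smul, hinv, Module.End.one_apply]
    have hdim : finrank ℂ V = 1 := by
      rw [← finrank_top ℂ V, ← htop, finrank_span_singleton hs]
    refine ⟨Or.inl hdim, knutson_trivial fun g => ?_⟩
    rw [Representation.character, hone, LinearMap.trace_one, hdim, Nat.cast_one]

omit [FiniteDimensional ℂ V] in
theorem hh_mul_uProj_zero (ρ : Representation ℂ (SL F) V) (ψ : AddChar F ℂ) (a : Fˣ) :
    ρ (hh a) * uProj ρ ψ 0 = uProj ρ ψ 0 * ρ (hh a) := by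
  rw [hh_mul_uProj, zero_mul]

omit [FiniteDimensional ℂ V] in
theorem uProj_mul_isoProj (ρ : Representation ℂ (SL F) V) (ψ : AddChar F ℂ) (l : Fˣ →* ℂ)
    [Fintype Fˣ] :
    uProj ρ ψ 0 * isoProj (MonoidHom.comp ρ hh) l = isoProj (MonoidHom.comp ρ hh) l * uProj ρ ψ 0 := by
  simp [isoProj, Finset.mul_sum, Finset.sum_mul, hh_mul_uProj_zero]

theorem knutson_upper [Fintype (SL F)] (hρ : ρ.IsIrreducible) (h2 : (2 : F) ≠ 0)
    (hψ : ψ.IsPrimitive) :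
    KnutsonIndex (SL F) ρ.character = 1 ∨ KnutsonIndex (SL F) ρ.character = 2 := by
  classical
  by_cases h0 : uProj ρ ψ 0 = 0
  · exact (knutson_cuspidal hρ h2 hψ h0).2
  have hE := LinearMap.congr_fun (isIdempotentElem_uProj ρ ψ 0).eq
  by_cases hl : ∃ l : Fˣ →* ℂ, l ≠ 1 ∧ isoProj (MonoidHom.comp ρ hh) l * uProj ρ ψ 0 ≠ 0
  · obtain ⟨l, hl1, hl⟩ := hl
    obtain ⟨y, hy⟩ : ∃ y, (isoProj (MonoidHom.comp ρ hh) l * uProj ρ ψ 0) y ≠ 0 := by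
      by_contra! h
      exact hl (LinearMap.ext h)
    refine (knutson_principal (ψ := ψ) hρ h2 hy ?_ (α := l) (fun a => ?_) hl1).2
    · rw [← uProj_mul_isoProj]
      exact hE _
    · exact LinearMap.congr_fun (mul_isoProj (MonoidHom.comp ρ hh) l a) _
  · push Not at hl
    obtain ⟨y, hy⟩ : ∃ y, uProj ρ ψ 0 y ≠ 0 := by
      by_contra! h
      exact h0 (LinearMap.ext h)
    refine Or.inl (knutson_steinberg (ψ := ψ) hρ hy (hE y) fun a => ?_).2
    exact LinearMap.congr_fun (mul_eq_self_of_isoProj_mul_eq_zero (MonoidHom.comp ρ hh) hl a) y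

end Cases

section LowerBound

variable {F : Type} [Field F] [Fintype F]

theorem card_SL : Nat.card (SL F) = Fintype.card F * (Nat.card Fˣ) * (Fintype.card F + 1) := by
  classical
  let f : (Fˣ × F) ⊕ (F × Fˣ × F) → SL F :=
    Sum.elim (fun p => hh p.1 * uu p.2) (fun p => uu p.1 * wh p.2.1 * uu p.2.2)
  have hl10 : ∀ p : Fˣ × F, f (Sum.inl p) 1 0 = 0 := fun p => by simp [f, mul_apply]
  have hr10 : ∀ p : F × Fˣ × F, f (Sum.inr p) 1 0 = -(p.2.1 : F) := fun p => by
    simp [f, mul_apply, wh]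
  have hf : Function.Bijective f := by
    constructor
    · rintro (⟨a, x⟩ | ⟨x, c, y⟩) (⟨a', x'⟩ | ⟨x', c', y'⟩) h
      · have e1 := congrArg (fun g : SL F => g 0 0) h
        have e2 := congrArg (fun g : SL F => g 0 1) h
        simp [f, mul_apply] at e1 e2
        obtain rfl := Units.ext e1
        simpa using e2
      · have e := congrArg (fun g : SL F => g 1 0) h
        simp only [hl10, hr10] at e
        exact absurd e.symm (by simp)
      · have e := congrArg (fun g : SL F => g 1 0) h
        simp only [hl10, hr10] at e
        exact absurd e (by simp)
      · have e := congrArg (fun g : SL F => g 1 0) h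
        have e1 := congrArg (fun g : SL F => g 0 0) h
        have e2 := congrArg (fun g : SL F => g 1 1) h
        simp only [hr10, neg_inj, Units.val_inj] at e
        subst e
        simp [f, mul_apply, wh] at e1 e2
        simp [e1, e2]
    · intro g
      by_cases hg : g 1 0 = 0
      · obtain ⟨a, -, h⟩ := borel g hg
        exact ⟨Sum.inl (a, _), h.symm⟩
      · exact ⟨Sum.inr (_, _, _), (bruhat g (Units.mk0 _ hg) rfl).symm⟩
  have hpos : Fintype.card F = Nat.card Fˣ + 1 := by
    rw [← card_units_eq, Nat.sub_add_cancel Fintype.card_pos]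
  rw [← Nat.card_congr (Equiv.ofBijective f hf), Nat.card_sum, Nat.card_prod, Nat.card_prod,
    Nat.card_prod, Nat.card_eq_fintype_card (α := F)]
  ring

theorem exists_character_sub_eq {V : Type} [AddCommGroup V] [Module ℂ V] [FiniteDimensional ℂ V]
    (h2 : (2 : F) ≠ 0) (ρ : Representation ℂ (SL F) V) :
    ∃ n : ℕ, ρ.character 1 - ρ.character (-1) = 4 * n := by
  set J : Module.End ℂ V := ρ ww with hJ
  have hJ2 : J ^ 2 = ρ (-1) := by rw [sq, hJ, ← map_mul, ww_mul_ww]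
  have hJ4 : J ^ 4 = 1 := by
    rw [show 4 = 2 + 2 from rfl, pow_add, hJ2, ← map_mul]
    simp
  have hww3 : (-1 : SL F) * ww = ww⁻¹ := by
    rw [eq_inv_iff_mul_eq_one, mul_assoc, ww_mul_ww]
    simp
  have hJ3 : J ^ 3 = ρ ww⁻¹ := by rw [pow_succ, hJ2, hJ, ← map_mul, hww3]
  have hconj : ρ.character ww⁻¹ = ρ.character ww := by
    obtain ⟨a, b, hab⟩ := exists_sq_sub_eq h2 (δ := (-1 : F)) (by simp) (-1)
    let k : SL F := mk a b b (-a) (by linear_combination -hab)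
    have : k * ww * k⁻¹ = ww⁻¹ := by
      rw [mul_inv_eq_iff_eq_mul]
      apply sl_ext <;> simp [k, mul_apply, inv_00, inv_01, inv_10, inv_11]
    rw [← this, char_conj]
  obtain ⟨P, hPdef⟩ : ∃ P : Polynomial ℂ, P = Polynomial.C (1 / 4) * (1 - Polynomial.C Complex.I *
    Polynomial.X - Polynomial.X ^ 2 + Polynomial.C Complex.I * Polynomial.X ^ 3) := ⟨_, rfl⟩
  have hI : (Polynomial.C Complex.I : Polynomial ℂ) ^ 2 = -1 := by
    rw [← Polynomial.C_pow, Complex.I_sq]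
    simp
  have h4 : (Polynomial.C (1 / 4) : Polynomial ℂ) * 4 = 1 := by
    rw [show (4 : Polynomial ℂ) = Polynomial.C 4 from rfl, ← Polynomial.C_mul]
    norm_num
  have hP : P * P = P + (Polynomial.X ^ 4 - 1) * (Polynomial.C (1 / 4) ^ 2 *
      (-Polynomial.X ^ 2 - 2 * Polynomial.C Complex.I * Polynomial.X + 3)) := by
    rw [hPdef]
    generalize (Polynomial.C Complex.I : Polynomial ℂ) = i at *
    generalize (Polynomial.C (1 / 4) : Polynomial ℂ) = t at *
    generalize (Polynomial.X : Polynomial ℂ) = X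
    linear_combination (t ^ 2 * (X - X ^ 3) ^ 2) * hI + t * (1 - i * X - X ^ 2 + i * X ^ 3) * h4
  have hp : IsIdempotentElem (Polynomial.aeval J P) := by
    have := congrArg (Polynomial.aeval J) hP
    rwa [map_mul, map_add, map_mul _ (_ - _), map_sub, map_pow, Polynomial.aeval_X, hJ4, map_one,
      sub_self, zero_mul, add_zero] at this
  obtain ⟨n, hn⟩ := exists_nat_trace_eq hp
  refine ⟨n, ?_⟩
  have h1 : Polynomial.aeval J P = (1 / 4 : ℂ) • (1 - Complex.I • J - J ^ 2 + Complex.I • J ^ 3) := by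
    simp [hPdef, Algebra.smul_def]
  have e1 : LinearMap.trace ℂ V 1 = ρ.character 1 := by
    rw [Representation.character, map_one ρ]
  have e2 : LinearMap.trace ℂ V J = ρ.character ww := rfl
  have e3 : LinearMap.trace ℂ V (J ^ 2) = ρ.character (-1) := by rw [hJ2, Representation.character]
  have e4 : LinearMap.trace ℂ V (J ^ 3) = ρ.character ww := by
    rw [hJ3, ← hconj, Representation.character]
  rw [h1, map_smul, map_add, map_sub, map_sub, map_smul, map_smul, e1, e2, e3, e4, smul_eq_mul] at hn
  linear_combination 4 * hn

theorem exists_virtual_sub_eq (h2 : (2 : F) ≠ 0) {φ : SL F → ℂ} (hφ : IsVirtualChar (SL F) φ) :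
    ∃ n : ℤ, φ 1 - φ (-1) = 4 * n := by
  have : Finite (SL F) := Subtype.finite
  induction hφ using Submodule.span_induction with
  | mem χ hχ =>
    obtain ⟨V, _, _, _, ρ, -, rfl⟩ := (isIrrChar_iff χ).1 hχ
    obtain ⟨n, hn⟩ := exists_character_sub_eq h2 ρ
    exact ⟨n, by rw [hn]; simp⟩
  | zero => exact ⟨0, by simp⟩
  | add x y _ _ hx hy =>
    obtain ⟨m, hm⟩ := hx
    obtain ⟨n, hn⟩ := hy
    refine ⟨m + n, ?_⟩
    rw [Pi.add_apply, Pi.add_apply]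
    push_cast
    linear_combination hm + hn
  | smul c x _ hx =>
    obtain ⟨m, hm⟩ := hx
    refine ⟨c * m, ?_⟩
    rw [Pi.smul_apply, Pi.smul_apply, zsmul_eq_mul, zsmul_eq_mul]
    push_cast
    linear_combination (c : ℂ) * hm

theorem four_mul_finrank_dvd {V : Type} [AddCommGroup V] [Module ℂ V] [FiniteDimensional ℂ V]
    (h2 : (2 : F) ≠ 0) {ρ : Representation ℂ (SL F) V} (hρ : ρ.IsIrreducible) {φ : SL F → ℂ}
    (hφ : IsVirtualChar (SL F) φ) (h : ρ.character * φ = regChar (SL F)) :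
    4 * finrank ℂ V ∣ Nat.card (SL F) := by
  have : Nontrivial V := ((isIrreducible_iff ρ).1 hρ).1
  have hpos : (finrank ℂ V : ℂ) ≠ 0 := by simp [finrank_pos.ne']
  obtain ⟨ε, hε, hz⟩ := exists_central_sign hρ (z := -1) (by simp) neg_one_comm
  have hχz : ρ.character (-1) = ε * finrank ℂ V := by
    have : ρ (-1) = ε • 1 := LinearMap.ext fun v => by simp [hz]
    rw [Representation.character, this]
    simp
  have hne : (-1 : SL F) ≠ 1 := by
    intro h
    have h1 := congrArg (fun g : SL F => g 0 0) h
    exact h2 (by simp at h1; linear_combination -h1)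
  have h1 := congrFun h 1
  have h3 := congrFun h (-1)
  rw [Pi.mul_apply, regChar, if_pos rfl, char_one] at h1
  rw [Pi.mul_apply, regChar, if_neg hne, hχz] at h3
  have h4 : φ (-1) = 0 := by
    refine (mul_eq_zero.1 h3).resolve_left (mul_ne_zero ?_ hpos)
    rcases hε with rfl | rfl <;> norm_num
  obtain ⟨n, hn⟩ := exists_virtual_sub_eq h2 hφ
  rw [h4, sub_zero] at hn
  rw [hn] at h1
  rw [← Int.natCast_dvd_natCast]
  refine ⟨n, ?_⟩
  have : ((Nat.card (SL F) : ℤ) : ℂ) = ((((4 * finrank ℂ V : ℕ) : ℤ) * n : ℤ) : ℂ) := by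
    push_cast
    rw [← h1]
    ring
  exact_mod_cast this

theorem card_sub_one_not_invertible {V : Type} [AddCommGroup V] [Module ℂ V]
    [FiniteDimensional ℂ V] (h2 : (2 : F) ≠ 0) {ρ : Representation ℂ (SL F) V}
    (hρ : ρ.IsIrreducible) (hq : Fintype.card F % 4 = 1)
    (hd : finrank ℂ V = Fintype.card F - 1) {φ : SL F → ℂ} (hφ : IsVirtualChar (SL F) φ) :
    ρ.character * φ ≠ regChar (SL F) := by
  intro h
  have h1 := four_mul_finrank_dvd h2 hρ hφ h
  have hpos : 0 < Fintype.card F - 1 := Nat.sub_pos_of_lt Fintype.one_lt_card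
  rw [hd, card_SL, ← card_units_eq, mul_right_comm] at h1
  have h3 := Nat.dvd_of_mul_dvd_mul_right hpos h1
  rw [Nat.dvd_iff_mod_eq_zero, Nat.mul_mod, Nat.add_mod, hq] at h3
  norm_num at h3

theorem card_add_one_not_invertible {V : Type} [AddCommGroup V] [Module ℂ V]
    [FiniteDimensional ℂ V] (h2 : (2 : F) ≠ 0) {ρ : Representation ℂ (SL F) V}
    (hρ : ρ.IsIrreducible) (hq : Fintype.card F % 4 = 3)
    (hd : finrank ℂ V = Fintype.card F + 1) {φ : SL F → ℂ} (hφ : IsVirtualChar (SL F) φ) :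
    ρ.character * φ ≠ regChar (SL F) := by
  intro h
  have h1 := four_mul_finrank_dvd h2 hρ hφ h
  rw [hd, card_SL, ← card_units_eq] at h1
  have h3 := Nat.dvd_of_mul_dvd_mul_right (Nat.succ_pos _) h1
  have h4 : (Fintype.card F - 1) % 4 = 2 := by omega
  rw [Nat.dvd_iff_mod_eq_zero, Nat.mul_mod, h4, hq] at h3
  norm_num at h3

end LowerBound

section Discrete

variable {F : Type} [Field F] [Fintype F] {𝒜 : Type*} [Ring 𝒜] [Algebra ℂ 𝒜]

/-- A combination of big-cell elements linking the `1`- and `δ`-eigenspaces of the unipotent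
subgroup. -/
noncomputable def linkElt (φ : SL F →* 𝒜) (ψ : AddChar F ℂ) (δ : F) (d : Fˣ → ℂ) [Fintype Fˣ] : 𝒜 :=
  ∑ b, d b • (uProj φ ψ δ * φ (wh b) * uProj φ ψ 1)

variable [Fintype Fˣ] (φ : SL F →* 𝒜) (ψ : AddChar F ℂ) {δ : F} (d : Fˣ → ℂ)

theorem map_linkElt {ℬ : Type*} [Ring ℬ] [Algebra ℂ ℬ] (f : 𝒜 →ₐ[ℂ] ℬ) :
    f (linkElt φ ψ δ d) = linkElt ((f : 𝒜 →* ℬ).comp φ) ψ δ d := by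
  simp [linkElt, map_uProj]

theorem uProj_mul_linkElt : uProj φ ψ δ * linkElt φ ψ δ d = linkElt φ ψ δ d := by
  simp only [linkElt, Finset.mul_sum, mul_smul_comm, ← mul_assoc, (isIdempotentElem_uProj φ ψ δ).eq]

theorem linkElt_mul_uProj : linkElt φ ψ δ d * uProj φ ψ 1 = linkElt φ ψ δ d := by
  simp only [linkElt, Finset.sum_mul, smul_mul_assoc, mul_assoc, (isIdempotentElem_uProj φ ψ 1).eq]

theorem uProj_zero_mul_linkElt (hψ : ψ.IsPrimitive) (hδ : δ ≠ 0)
    (hd : ∀ y : Fˣ, ∑ b : Fˣ, d b * ψ (-((b : F)⁻¹ * (δ * y + (y : F)⁻¹))) = 0) (g : SL F) :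
    uProj φ ψ 0 * φ g * linkElt φ ψ δ d = 0 := by
  classical
  obtain rfl : ‹Fintype Fˣ› = instFintypeUnitsOfDecidableEq := Subsingleton.elim _ _
  rw [← uProj_mul_linkElt, ← mul_assoc]
  by_cases hg : g 1 0 = 0
  · obtain ⟨a, -, h⟩ := borel g hg
    have h1 : uProj φ ψ 0 * φ g * uProj φ ψ δ = 0 := by
      rw [h, map_mul, ← mul_assoc, mul_assoc _ (φ (uu _)), uu_mul_uProj, mul_smul_comm,
        uProj_hh_uProj_eq_zero φ ψ hψ, smul_zero]
      exact (mul_ne_zero hδ (by simp)).symm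
    rw [h1, zero_mul]
  · obtain ⟨a, k, hk⟩ : ∃ (a : Fˣ) (k : ℂ), uProj φ ψ 0 * φ g * uProj φ ψ δ =
        k • (uProj φ ψ 0 * φ (wh a) * uProj φ ψ δ) := by
      refine ⟨-(Units.mk0 _ hg), ψ (δ * (g 1 1 / (Units.mk0 _ hg : Fˣ))), ?_⟩
      conv_lhs => rw [bruhat g (Units.mk0 _ hg) rfl]
      rw [map_mul, map_mul, ← mul_assoc, ← mul_assoc, uProj_mul_uu, mul_assoc _ (φ (uu _)),
        uu_mul_uProj]
      simp
    rw [hk, smul_mul_assoc, mul_assoc, uProj_mul_linkElt, linkElt, Finset.mul_sum]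
    have h1 : ∀ b : Fˣ, uProj φ ψ 0 * φ (wh a) * (d b • (uProj φ ψ δ * φ (wh b) * uProj φ ψ 1)) =
        (Fintype.card F : ℂ)⁻¹ • ∑ y : Fˣ, (d b * ψ (-((b : F)⁻¹ * (δ * y + (y : F)⁻¹)))) •
          (uProj φ ψ 0 * φ (wh (-(a * y))) * uProj φ ψ 1) := by
      intro b
      have h2 := uProj_wh_uProj_wh_uProj φ ψ a b 0 δ 1
      rw [uProj_hh_uProj_eq_zero φ ψ hψ (by
        rw [one_mul]
        exact (inv_ne_zero (pow_ne_zero 2 (Units.ne_zero _))).symm), zero_add] at h2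
      rw [mul_smul_comm, ← mul_assoc, ← mul_assoc, h2, smul_comm (d b), Finset.smul_sum]
      congr 1
      refine Fintype.sum_equiv (Equiv.mulLeft b) _ _ fun x => ?_
      rw [smul_smul, Equiv.coe_mulLeft, ← mul_assoc]
      congr 4
      push_cast
      field_simp
      ring
    simp_rw [h1]
    rw [← Finset.smul_sum, Finset.sum_comm]
    simp_rw [← Finset.sum_smul, hd]
    simp

theorem exists_units_function (hq : Fintype.card F % 4 = 1)
    (hψ : ψ.IsPrimitive) (hδ : ¬ IsSquare δ) :
    ∃ d : Fˣ → ℂ, d ≠ 0 ∧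
      ∀ y : Fˣ, ∑ b : Fˣ, d b * ψ (-((b : F)⁻¹ * (δ * y + (y : F)⁻¹))) = 0 := by
  classical
  have hδ0 : δ ≠ 0 := by rintro rfl; exact hδ ⟨0, by simp⟩
  have h0 : ∀ y : Fˣ, δ * y + (y : F)⁻¹ ≠ 0 := by
    intro y hy
    obtain ⟨i, hi⟩ := FiniteField.isSquare_neg_one_iff.2 (show Fintype.card F % 4 ≠ 3 by omega)
    refine hδ ⟨i * (y : F)⁻¹, ?_⟩
    have hy0 := y.ne_zero
    field_simp at hy ⊢
    linear_combination hy + hi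
  obtain ⟨s, hs0, hs⟩ : ∃ s : F, s ≠ 0 ∧ ∀ y : Fˣ, δ * y + (y : F)⁻¹ ≠ s := by
    let f : Fˣ → Fˣ := fun y => Units.mk0 _ (h0 y)
    have hf : ¬ Function.Surjective f := by
      intro hsurj
      have hinj := Finite.injective_iff_surjective.2 hsurj
      have h1 : f 1 = f (Units.mk0 δ hδ0)⁻¹ := by
        ext
        simp [f, hδ0, add_comm]
      have h3 := congrArg Units.val (hinj h1)
      refine hδ ⟨1, ?_⟩
      simp at h3
      simpa using h3
    rw [Function.Surjective] at hf
    push Not at hf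
    obtain ⟨s, hs⟩ := hf
    exact ⟨s, s.ne_zero, fun y h => hs y (Units.ext h)⟩
  have hsum : ∀ c : F, c ≠ 0 → ∑ b : Fˣ, ψ ((b : F)⁻¹ * c) = -1 := by
    intro c hc
    have h1 : ∑ x, ψ (x * c) = 0 := by
      rw [AddChar.sum_mulShift c hψ, if_neg hc]
      simp
    rw [← Finset.add_sum_erase _ _ (Finset.mem_univ (0 : F)), zero_mul,
      AddChar.map_zero_eq_one] at h1
    rw [← eq_neg_of_add_eq_zero_right h1]
    refine Finset.sum_bij (fun b _ => (b : F)⁻¹) (by simp) (by simp [Units.ext_iff])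
      (fun x hx => ⟨(Units.mk0 x (by simpa using hx))⁻¹, by simp⟩) (fun _ _ => rfl)
  refine ⟨fun b => ψ ((b : F)⁻¹ * s) - 1, ?_, fun y => ?_⟩
  · intro h
    refine hψ hs0 (DFunLike.ext _ _ fun x => ?_)
    rw [AddChar.mulShift_apply, AddChar.one_apply]
    by_cases hx : x = 0
    · simp [hx]
    · have := congrFun h (Units.mk0 x hx)⁻¹
      simpa [sub_eq_zero, mul_comm] using this
  · have h1 := hsum (s - (δ * y + (y : F)⁻¹)) (sub_ne_zero.2 (hs y).symm)
    have h3 := hsum (-(δ * y + (y : F)⁻¹)) (neg_ne_zero.2 (h0 y))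
    simp_rw [sub_mul, one_mul, ← AddChar.map_add_eq_mul]
    rw [Finset.sum_sub_distrib]
    simp only [mul_neg] at h3
    simp only [mul_sub] at h1
    simp only [← sub_eq_add_neg, h1, h3, sub_self]

end Discrete

section GroupAlgebra

variable {G : Type} [Group G]

/-- The coefficient of a group algebra element at `g`. -/
noncomputable def coeffAt (g : G) : MonoidAlgebra ℂ G →ₗ[ℂ] ℂ :=
  (Finsupp.lapply g).comp
    (MonoidAlgebra.coeffLinearEquiv (R := ℂ) (S := ℂ) (M := G)).toLinearMap

theorem coeffAt_of [DecidableEq G] (g h : G) :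
    coeffAt g (MonoidAlgebra.of ℂ G h) = if h = g then 1 else 0 := by
  simp [coeffAt, Finsupp.single_apply]

variable {F : Type} [Field F] [Fintype F] [Fintype Fˣ]

theorem linkElt_of_ne_zero (ψ : AddChar F ℂ) (δ : F) {d : Fˣ → ℂ} (hd : d ≠ 0) :
    linkElt (MonoidAlgebra.of ℂ (SL F)) ψ δ d ≠ 0 := by
  classical
  obtain ⟨b₀, hb₀⟩ := Function.ne_iff.1 hd
  intro h
  have h1 := congrArg (coeffAt (wh b₀)) h
  have key : ∀ (b : Fˣ) (x y : F), uu x * wh b * uu y = wh b₀ ↔ b = b₀ ∧ x = 0 ∧ y = 0 := by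
    intro b x y
    constructor
    · intro h
      have e := congrArg (fun g : SL F => g 1 0) h
      have e1 := congrArg (fun g : SL F => g 0 0) h
      have e2 := congrArg (fun g : SL F => g 1 1) h
      simp [mul_apply, wh] at e e1 e2
      exact ⟨Units.ext e, e1, e2⟩
    · rintro ⟨rfl, rfl, rfl⟩
      simp
  have h3 : ∀ b, uProj (MonoidAlgebra.of ℂ (SL F)) ψ δ * MonoidAlgebra.of ℂ (SL F) (wh b) *
      uProj (MonoidAlgebra.of ℂ (SL F)) ψ 1 = ((Fintype.card F : ℂ)⁻¹ * (Fintype.card F : ℂ)⁻¹) •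
      ∑ x, ∑ y, (ψ (-(δ * x)) * ψ (-(1 * y))) • MonoidAlgebra.of ℂ (SL F) (uu x * wh b * uu y) := by
    intro b
    rw [uProj_eq, uProj_eq]
    simp only [Finset.sum_mul, Finset.mul_sum, smul_mul_assoc, mul_smul_comm, smul_smul, map_mul,
      Finset.smul_sum]
    rw [Finset.sum_comm]
    refine Finset.sum_congr rfl fun x _ => Finset.sum_congr rfl fun y _ => ?_
    congr 1
    ring
  simp only [linkElt, h3, map_sum, map_smul, coeffAt_of, key, smul_eq_mul, map_zero] at h1
  rw [Finset.sum_eq_single b₀ (fun b _ hb => by simp [hb]) (by simp),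
    Finset.sum_eq_single (0 : F) (fun x _ hx => by simp [hx]) (by simp),
    Finset.sum_eq_single (0 : F) (fun x _ hx => by simp [hx]) (by simp)] at h1
  simp at h1
  exact hb₀ h1

theorem uProj_mul_isoProj_of_ne_zero (ψ : AddChar F ℂ) (α : Fˣ →* ℂ) :
    uProj (MonoidAlgebra.of ℂ (SL F)) ψ 0 *
      isoProj ((MonoidAlgebra.of ℂ (SL F)).comp hh) α ≠ 0 := by
  classical
  intro h
  have h1 := congrArg (coeffAt 1) h
  have key : ∀ (a : Fˣ) (x : F), uu x * hh a = 1 ↔ a = 1 ∧ x = 0 := by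
    intro a x
    constructor
    · intro h
      have e := congrArg (fun g : SL F => g 0 0) h
      have e1 := congrArg (fun g : SL F => g 0 1) h
      simp [mul_apply] at e e1
      exact ⟨e, e1⟩
    · rintro ⟨rfl, rfl⟩
      simp
  rw [uProj_eq, isoProj] at h1
  simp only [Finset.sum_mul, Finset.mul_sum, smul_mul_assoc, mul_smul_comm, smul_smul,
    MonoidHom.comp_apply, ← map_mul, map_sum, map_smul, coeffAt_of, key, smul_eq_mul, map_zero] at h1
  rw [Finset.sum_eq_single (1 : Fˣ) (fun b _ hb => by simp [hb]) (by simp),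
    Finset.sum_eq_single (0 : F) (fun x _ hx => by simp [hx]) (by simp)] at h1
  simp at h1

end GroupAlgebra

section Existence

variable {F : Type} [Field F] [Fintype F] {ψ : AddChar F ℂ}

theorem isSquare_or_isSquare_mul {δ : F} (hδ : ¬ IsSquare δ) (c : F) :
    IsSquare c ∨ IsSquare (c * δ) := by
  classical
  by_cases hc : IsSquare c
  · exact Or.inl hc
  · right
    have hc0 : c ≠ 0 := by rintro rfl; exact hc ⟨0, by simp⟩
    have hδ0 : δ ≠ 0 := by rintro rfl; exact hδ ⟨0, by simp⟩
    rw [← quadraticChar_one_iff_isSquare (mul_ne_zero hc0 hδ0), map_mul,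
      quadraticChar_neg_one_iff_not_isSquare.2 hc, quadraticChar_neg_one_iff_not_isSquare.2 hδ]
    norm_num

theorem uProj_ne_zero_of_isSquare {V : Type} [AddCommGroup V] [Module ℂ V]
    {ρ : Representation ℂ (SL F) V} {r c : F} (hr : r ≠ 0) (hc : c ≠ 0) (hs : IsSquare (r / c))
    (h : uProj ρ ψ r ≠ 0) : uProj ρ ψ c ≠ 0 := by
  obtain ⟨a, ha⟩ := hs
  have ha0 : a ≠ 0 := by
    rintro rfl
    rw [zero_mul] at ha
    exact div_ne_zero hr hc ha
  intro h0
  have h1 := hh_mul_uProj (ψ := ψ) ρ (Units.mk0 a ha0) r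
  have h3 : r * (((Units.mk0 a ha0 : Fˣ) : F) ^ 2)⁻¹ = c := by
    rw [Units.val_mk0, sq, ← ha]
    field_simp
  rw [h3, h0, zero_mul] at h1
  apply h
  rw [← one_mul (uProj ρ ψ r), ← map_one ρ, ← inv_mul_cancel (hh (Units.mk0 a ha0)), map_mul,
    mul_assoc, h1, mul_zero]

theorem exists_irreducible_card_sub_one (h2 : (2 : F) ≠ 0) (hψ : ψ.IsPrimitive)
    (hq : Fintype.card F % 4 = 1) :
    ∃ (V : Type) (_ : AddCommGroup V) (_ : Module ℂ V) (_ : FiniteDimensional ℂ V)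
      (ρ : Representation ℂ (SL F) V), ρ.IsIrreducible ∧ finrank ℂ V = Fintype.card F - 1 := by
  classical
  have : Finite (SL F) := Subtype.finite
  obtain ⟨δ, hδ⟩ := FiniteField.exists_nonsquare (ringChar_ne_two h2)
  have hδ0 : δ ≠ 0 := by rintro rfl; exact hδ ⟨0, by simp⟩
  obtain ⟨d, hd0, hd⟩ := exists_units_function ψ hq hψ hδ
  obtain ⟨V, _, _, _, ρ, hρ, hne⟩ := exists_irreducible_ne_zero _ (linkElt_of_ne_zero ψ δ hd0)
  rw [map_linkElt] at hne
  have hcomp : ((ρ.asAlgebraHom : MonoidAlgebra ℂ (SL F) →* Module.End ℂ V).comp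
      (MonoidAlgebra.of ℂ (SL F))) = ρ := by
    ext g : 1
    simp
  rw [hcomp] at hne
  refine ⟨V, _, _, ‹_›, ρ, hρ, ?_⟩
  obtain ⟨v, hv⟩ : ∃ v, linkElt ρ ψ δ d v ≠ 0 := by
    by_contra! h
    exact hne (LinearMap.ext h)
  have h0 : uProj ρ ψ 0 = 0 := by
    have htop : (⊤ : Submodule ℂ V) ≤ LinearMap.ker (uProj ρ ψ 0) := by
      rw [← span_orbit_eq_top hρ hv, Submodule.span_le]
      rintro _ ⟨g, rfl⟩
      exact LinearMap.congr_fun (uProj_zero_mul_linkElt ρ ψ d hψ hδ0 hd g) v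
    exact LinearMap.ext fun x => htop Submodule.mem_top
  have h1 : uProj ρ ψ 1 ≠ 0 := by
    intro h
    rw [← linkElt_mul_uProj, h, mul_zero] at hne
    exact hne rfl
  have hδ1 : uProj ρ ψ δ ≠ 0 := by
    intro h
    rw [← uProj_mul_linkElt, h, zero_mul] at hne
    exact hne rfl
  have hall : ∀ c : F, c ≠ 0 → uProj ρ ψ c ≠ 0 := by
    intro c hc
    rcases isSquare_or_isSquare_mul hδ c with ⟨b, hb⟩ | ⟨b, hb⟩
    · refine uProj_ne_zero_of_isSquare one_ne_zero hc ⟨b⁻¹, ?_⟩ h1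
      rw [hb, one_div, mul_inv]
    · refine uProj_ne_zero_of_isSquare hδ0 hc ⟨b / c, ?_⟩ hδ1
      field_simp
      rw [mul_comm, hb, sq]
  refine le_antisymm (finrank_le_of_uProj_zero hρ hψ h0) ?_
  rw [finrank_eq_sum_uProj ρ hψ, ← Finset.add_sum_erase _ _ (Finset.mem_univ (0 : F))]
  refine le_trans ?_ (Nat.le_add_left _ _)
  have h3 := Finset.card_nsmul_le_sum (Finset.univ.erase (0 : F))
    (fun r => finrank ℂ (LinearMap.range (uProj ρ ψ r))) 1 (fun c hc => by
      have hc0 := hall c (Finset.ne_of_mem_erase hc)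
      rw [Nat.one_le_iff_ne_zero, Ne, Submodule.finrank_eq_zero, LinearMap.range_eq_bot]
      exact hc0)
  simpa [Finset.card_erase_of_mem] using h3

theorem exists_hom_sq_ne_one (h5 : 5 ≤ Fintype.card F) : ∃ α : Fˣ →* ℂ, ∃ t, α (t * t) ≠ 1 := by
  classical
  obtain ⟨t, ht⟩ : ∃ t : Fˣ, t * t ≠ 1 := by
    by_contra! h
    have h1 : (Finset.univ : Finset Fˣ) ⊆ {1, -1} := by
      intro t _
      have := mul_self_eq_one_iff.1 (congrArg Units.val (h t) : (t : F) * t = 1)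
      rw [Finset.mem_insert, Finset.mem_singleton, Units.ext_iff, Units.ext_iff]
      simpa using this
    have h3 := (Finset.card_le_card h1).trans Finset.card_le_two
    rw [Finset.card_univ, ← Nat.card_eq_fintype_card, ← card_units_eq] at h3
    omega
  obtain ⟨l, hl⟩ := CommGroup.exists_apply_ne_one_of_hasEnoughRootsOfUnity Fˣ ℂ ht
  exact ⟨(Units.coeHom ℂ).comp l, t, fun h => hl (Units.ext h)⟩

theorem uProj_ww_ne_zero {V : Type} [AddCommGroup V] [Module ℂ V] {ρ : Representation ℂ (SL F) V}
    {v : V} (hv0 : v ≠ 0) (hv : uProj ρ ψ 0 v = v) {α : Fˣ →* ℂ}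
    (hα : ∀ a, ρ (hh a) v = α a • v) : uProj ρ ψ 0 (ρ ww v) ≠ 0 := by
  classical
  intro h0
  have h := LinearMap.congr_fun (uProj_wh_uProj_wh_uProj ρ ψ 1 1 0 0 0) v
  have hw : ∀ a, uProj ρ ψ 0 (ρ (wh a) v) = 0 := fun a => by
    rw [wh, map_mul, Module.End.mul_apply, hα, map_smul, map_smul, h0, smul_zero]
  simp only [Module.End.mul_apply, LinearMap.smul_apply, LinearMap.add_apply, LinearMap.sum_apply,
    hv, hw, map_zero, smul_zero, Finset.sum_const_zero, add_zero, hα, map_smul] at h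
  have hne : α (-(1 * 1⁻¹)) ≠ 0 := fun h => by
    have := congrArg α (show (-(1 * 1⁻¹) : Fˣ) * -1 = 1 by simp)
    rw [map_mul, h, zero_mul, map_one] at this
    exact zero_ne_one this
  exact smul_ne_zero (inv_ne_zero (by simp)) (smul_ne_zero hne hv0) h.symm

theorem two_le_finrank_range {V : Type} [AddCommGroup V] [Module ℂ V] [FiniteDimensional ℂ V]
    {ρ : Representation ℂ (SL F) V} {v : V} (hv0 : v ≠ 0) (hv : uProj ρ ψ 0 v = v) {α : Fˣ →* ℂ}
    (hα : ∀ a, ρ (hh a) v = α a • v) {t : Fˣ} (ht : α (t * t) ≠ 1) :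
    2 ≤ finrank ℂ (LinearMap.range (uProj ρ ψ 0)) := by
  set w := uProj ρ ψ 0 (ρ ww v) with hw
  have hw0 : w ≠ 0 := uProj_ww_ne_zero hv0 hv hα
  have hwα : ρ (hh t) w = α t⁻¹ • w := by
    have h := LinearMap.congr_fun (hh_mul_uProj_zero ρ ψ t) (ρ ww v)
    rw [Module.End.mul_apply, Module.End.mul_apply, ← Module.End.mul_apply (ρ (hh t)) (ρ ww), ← map_mul,
      hh_mul_ww, map_mul, Module.End.mul_apply, hα, map_smul, map_smul] at h
    exact h
  have hne : α t ≠ α t⁻¹ := by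
    intro h
    apply ht
    rw [map_mul]
    nth_rewrite 2 [h]
    rw [← map_mul, mul_inv_cancel, map_one]
  have hli : LinearIndependent ℂ ![v, w] := by
    rw [LinearIndependent.pair_iff]
    intro a b hab
    have h1 := congrArg (ρ (hh t)) hab
    rw [map_add, map_smul, map_smul, hα, hwα, map_zero] at h1
    have h3 : (b * (α t⁻¹ - α t)) • w = 0 := by
      have h4 : (b * (α t⁻¹ - α t)) • w =
          (a • α t • v + b • α t⁻¹ • w) - α t • (a • v + b • w) := by module
      rw [h4, h1, hab, smul_zero, sub_zero]
    have hb : b = 0 := (mul_eq_zero.1 ((smul_eq_zero.1 h3).resolve_right hw0)).resolve_right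
      (sub_ne_zero.2 hne.symm)
    rw [hb, zero_smul, add_zero] at hab
    exact ⟨(smul_eq_zero.1 hab).resolve_right hv0, hb⟩
  have h := finrank_span_eq_card hli
  rw [Fintype.card_fin] at h
  refine h.symm.le.trans (Submodule.finrank_mono (Submodule.span_le.2 ?_))
  rintro _ ⟨i, rfl⟩
  fin_cases i
  · exact ⟨v, hv⟩
  · exact ⟨_, rfl⟩

theorem finrank_range_le_two {V : Type} [AddCommGroup V] [Module ℂ V] [FiniteDimensional ℂ V]
    {ρ : Representation ℂ (SL F) V} (hρ : ρ.IsIrreducible) {v : V} (hv0 : v ≠ 0)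
    (hv : uProj ρ ψ 0 v = v) {α : Fˣ →* ℂ} (hα : ∀ a, ρ (hh a) v = α a • v) :
    finrank ℂ (LinearMap.range (uProj ρ ψ 0)) ≤ 2 := by
  classical
  refine (Submodule.finrank_mono (range_uProj_le hρ hv0 hv hα)).trans ?_
  have h := finrank_span_finset_le_card (R := ℂ) ({v, uProj ρ ψ 0 (ρ ww v)} : Finset V)
  refine (le_of_eq ?_).trans (h.trans Finset.card_le_two)
  rw [Set.finrank, Finset.coe_pair]

theorem exists_two_mul_finrank_sub {V : Type} [AddCommGroup V] [Module ℂ V]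
    [FiniteDimensional ℂ V] (h2 : (2 : F) ≠ 0) (hψ : ψ.IsPrimitive)
    {ρ : Representation ℂ (SL F) V} (hρ : ρ.IsIrreducible) :
    ∃ n : ℕ, 2 * ((finrank ℂ V : ℂ) - finrank ℂ (LinearMap.range (uProj ρ ψ 0))) =
      (Nat.card Fˣ : ℂ) * n := by
  classical
  obtain ⟨ε, hε, hz⟩ := exists_central_sign hρ (z := hh (-1)) (by rw [← map_mul]; simp)
    (hh_central (by simp))
  obtain ⟨l, hl⟩ : ∃ l : Fˣ →* ℂ, l (-1) = ε := by
    rcases hε with rfl | rfl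
    · exact ⟨1, rfl⟩
    · exact exists_hom_eq_neg_one (neg_one_units_ne_one h2) (by simp)
  have hεε : ε * ε = 1 := by rcases hε with rfl | rfl <;> norm_num
  set P := isoProj (MonoidHom.comp ρ hh) l with hP
  have hPi : IsIdempotentElem P := isIdempotentElem_isoProj _ _
  have hE := isIdempotentElem_uProj ρ ψ 0
  have hcomm : P * (1 - uProj ρ ψ 0) = (1 - uProj ρ ψ 0) * P := by
    rw [mul_sub, sub_mul, mul_one, one_mul, uProj_mul_isoProj]
  have hQ : IsIdempotentElem (P * (1 - uProj ρ ψ 0)) :=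
    hPi.mul_of_commute hcomm hE.one_sub
  obtain ⟨n, hn⟩ := exists_nat_trace_eq hQ
  refine ⟨n, ?_⟩
  have htr : ∀ a : Fˣ, LinearMap.trace ℂ V (ρ (hh a) * (1 - uProj ρ ψ 0)) =
      ρ.character (hh a) - LinearMap.trace ℂ V (ρ (hh a) * uProj ρ ψ 0) := fun a => by
    rw [mul_sub, map_sub, mul_one, Representation.character]
  have htr0 : ∀ a : Fˣ, a ≠ 1 → a ≠ -1 →
      LinearMap.trace ℂ V (ρ (hh a) * (1 - uProj ρ ψ 0)) = 0 := by
    intro a ha ha'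
    rw [htr, character_hh ρ hψ, sub_self]
    intro h
    rcases mul_self_eq_one_iff.1 (congrArg Units.val h) with h | h
    · exact ha (Units.ext h)
    · exact ha' (Units.ext (by simpa using h))
  have hone : LinearMap.trace ℂ V (1 - uProj ρ ψ 0) =
      finrank ℂ V - finrank ℂ (LinearMap.range (uProj ρ ψ 0)) := by
    rw [map_sub, LinearMap.trace_one, trace_eq_finrank_range hE]
  have hneg : LinearMap.trace ℂ V (ρ (hh (-1)) * (1 - uProj ρ ψ 0)) =
      ε * (finrank ℂ V - finrank ℂ (LinearMap.range (uProj ρ ψ 0))) := by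
    have : ρ (hh (-1)) = ε • 1 := LinearMap.ext fun v => by rw [hz]; simp
    rw [this, smul_mul_assoc, one_mul, map_smul, hone, smul_eq_mul]
  have hA : (Fintype.card Fˣ : ℂ) ≠ 0 := by simp
  rw [hP, isoProj, smul_mul_assoc, Finset.sum_mul, map_smul, map_sum] at hn
  simp only [smul_mul_assoc, map_smul, MonoidHom.comp_apply, smul_eq_mul] at hn
  rw [← Finset.sum_subset (Finset.subset_univ {1, -1}) (fun a _ ha => by
    simp only [Finset.mem_insert, Finset.mem_singleton, not_or] at ha
    rw [htr0 a ha.1 ha.2, mul_zero]), Finset.sum_pair (neg_one_units_ne_one h2).symm,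
    inv_mul_eq_iff_eq_mul₀ hA, hneg, inv_one, map_one, map_one, map_one,
    one_mul (LinearMap.trace ℂ V _), one_mul (1 - uProj ρ ψ 0), hone,
    show (-1 : Fˣ)⁻¹ = -1 from by simp, hl] at hn
  rw [Nat.card_eq_fintype_card, ← hn]
  linear_combination (-(finrank ℂ V : ℂ) + finrank ℂ (LinearMap.range (uProj ρ ψ 0))) * hεε

theorem exists_irreducible_card_add_one (h2 : (2 : F) ≠ 0) (hψ : ψ.IsPrimitive)
    (h5 : 5 ≤ Fintype.card F) :
    ∃ (V : Type) (_ : AddCommGroup V) (_ : Module ℂ V) (_ : FiniteDimensional ℂ V)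
      (ρ : Representation ℂ (SL F) V), ρ.IsIrreducible ∧ finrank ℂ V = Fintype.card F + 1 := by
  classical
  have : Fintype (SL F) := Fintype.ofFinite _
  obtain ⟨α, t, ht⟩ := exists_hom_sq_ne_one h5
  obtain ⟨V, _, _, _, ρ, hρ, hne⟩ := exists_irreducible_ne_zero _ (uProj_mul_isoProj_of_ne_zero ψ α)
  have hcomp : ((ρ.asAlgebraHom : MonoidAlgebra ℂ (SL F) →* Module.End ℂ V).comp
      (MonoidAlgebra.of ℂ (SL F))) = ρ := by
    ext g : 1
    simp
  rw [map_mul, map_uProj, map_isoProj, ← MonoidHom.comp_assoc, hcomp, uProj_mul_isoProj] at hne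
  refine ⟨V, _, _, ‹_›, ρ, hρ, ?_⟩
  obtain ⟨y, hy⟩ : ∃ y, (isoProj (MonoidHom.comp ρ hh) α * uProj ρ ψ 0) y ≠ 0 := by
    by_contra! h
    exact hne (LinearMap.ext h)
  have hv : uProj ρ ψ 0 ((isoProj (MonoidHom.comp ρ hh) α * uProj ρ ψ 0) y) =
      (isoProj (MonoidHom.comp ρ hh) α * uProj ρ ψ 0) y := by
    rw [← uProj_mul_isoProj]
    exact LinearMap.congr_fun (isIdempotentElem_uProj ρ ψ 0).eq _
  have hα : ∀ a, ρ (hh a) ((isoProj (MonoidHom.comp ρ hh) α * uProj ρ ψ 0) y) =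
      α a • (isoProj (MonoidHom.comp ρ hh) α * uProj ρ ψ 0) y := fun a =>
    LinearMap.congr_fun (mul_isoProj (MonoidHom.comp ρ hh) α a) _
  refine (knutson_principal hρ h2 hy hv hα (by rintro rfl; exact ht rfl)).1.resolve_left fun hd => ?_
  have h3 : finrank ℂ (LinearMap.range (uProj ρ ψ 0)) = 2 :=
    le_antisymm (finrank_range_le_two hρ hy hv hα) (two_le_finrank_range hy hv hα ht)
  obtain ⟨n, hn⟩ := exists_two_mul_finrank_sub h2 hψ hρ
  rw [h3] at hn
  have h4 : 2 * finrank ℂ V = Nat.card Fˣ * n + 4 := by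
    have : (2 * finrank ℂ V : ℂ) = Nat.card Fˣ * n + 4 := by
      push_cast at hn
      linear_combination hn
    exact_mod_cast this
  rw [hd, ← card_units_eq] at h4
  obtain ⟨m, hm⟩ : ∃ m, Fintype.card F = m + 5 := ⟨_, (Nat.sub_add_cancel h5).symm⟩
  rw [hm] at h4
  rcases n with _ | n
  · omega
  · have : m + 5 - 1 = m + 4 := rfl
    rw [this] at h4
    nlinarith

end Existence

theorem two_ne_zero_of_odd_card {F : Type} [Field F] [Fintype F] (h : Odd (Fintype.card F)) :
    (2 : F) ≠ 0 := by
  intro h2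
  obtain ⟨k, hk⟩ := h
  have h0 := Nat.cast_card_eq_zero F
  rw [hk] at h0
  push_cast at h0
  rw [h2, zero_mul, zero_add] at h0
  exact one_ne_zero h0

theorem exists_isPrimitive (F : Type) [Field F] [Finite F] :
    ∃ ψ : AddChar F ℂ, ψ.IsPrimitive := by
  obtain ⟨ψ, hψ⟩ := AddChar.exists_apply_ne_zero.2 (one_ne_zero (α := F))
  exact ⟨ψ, AddChar.IsPrimitive.of_ne_one fun h => hψ (by rw [h]; rfl)⟩

end Knutson

/-- For an odd prime power `q ≥ 5`, every irreducible character of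
`SL₂(𝔽_q)` has Knutson index `1` or `2`; if `q ≡ 1 (mod 4)` every irreducible character
of degree `q − 1` has Knutson index `2`, and if `q ≡ 3 (mod 4)` every irreducible
character of degree `q + 1` has Knutson index `2`.  In particular `ℂ[SL₂(𝔽_q)]` is not
of Knutson type. -/
theorem sl2_odd_knutson_indices (q : ℕ) (hq : IsPrimePow q) (hodd : Odd q) (h5 : 5 ≤ q)
    (F : Type) [Field F] [Fintype F] (hF : Fintype.card F = q) :
    (∀ χ : Matrix.SpecialLinearGroup (Fin 2) F → ℂ,
        IsIrrChar (Matrix.SpecialLinearGroup (Fin 2) F) χ →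
        KnutsonIndex (Matrix.SpecialLinearGroup (Fin 2) F) χ = 1 ∨
          KnutsonIndex (Matrix.SpecialLinearGroup (Fin 2) F) χ = 2) ∧
    (q % 4 = 1 → ∀ χ : Matrix.SpecialLinearGroup (Fin 2) F → ℂ,
        IsIrrChar (Matrix.SpecialLinearGroup (Fin 2) F) χ → χ 1 = ((q - 1 : ℕ) : ℂ) →
        KnutsonIndex (Matrix.SpecialLinearGroup (Fin 2) F) χ = 2) ∧
    (q % 4 = 3 → ∀ χ : Matrix.SpecialLinearGroup (Fin 2) F → ℂ,
        IsIrrChar (Matrix.SpecialLinearGroup (Fin 2) F) χ → χ 1 = ((q + 1 : ℕ) : ℂ) →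
        KnutsonIndex (Matrix.SpecialLinearGroup (Fin 2) F) χ = 2) ∧
    ¬ IsKnutsonType (Matrix.SpecialLinearGroup (Fin 2) F) := by
  subst hF
  classical
  have : Finite (Matrix.SpecialLinearGroup (Fin 2) F) := Subtype.finite
  have : Fintype (Matrix.SpecialLinearGroup (Fin 2) F) := Fintype.ofFinite _
  have h2 := Knutson.two_ne_zero_of_odd_card hodd
  obtain ⟨ψ, hψ⟩ := Knutson.exists_isPrimitive F
  have upper : ∀ χ : Matrix.SpecialLinearGroup (Fin 2) F → ℂ,
      IsIrrChar (Matrix.SpecialLinearGroup (Fin 2) F) χ →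
      KnutsonIndex (Matrix.SpecialLinearGroup (Fin 2) F) χ = 1 ∨
        KnutsonIndex (Matrix.SpecialLinearGroup (Fin 2) F) χ = 2 := by
    intro χ hχ
    obtain ⟨V, _, _, _, ρ, hρ, rfl⟩ := (Knutson.isIrrChar_iff χ).1 hχ
    exact Knutson.knutson_upper hρ h2 hψ
  refine ⟨upper, fun hq χ hχ h1 => ?_, fun hq χ hχ h1 => ?_, fun hK => ?_⟩
  · refine (upper χ hχ).resolve_left fun h => ?_
    obtain ⟨φ, hφ, hmul⟩ := Knutson.exists_of_knutsonIndex_eq_one h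
    obtain ⟨V, _, _, _, ρ, hρ, rfl⟩ := (Knutson.isIrrChar_iff χ).1 hχ
    rw [Representation.char_one] at h1
    exact Knutson.card_sub_one_not_invertible h2 hρ hq (by exact_mod_cast h1) hφ hmul
  · refine (upper χ hχ).resolve_left fun h => ?_
    obtain ⟨φ, hφ, hmul⟩ := Knutson.exists_of_knutsonIndex_eq_one h
    obtain ⟨V, _, _, _, ρ, hρ, rfl⟩ := (Knutson.isIrrChar_iff χ).1 hχ
    rw [Representation.char_one] at h1
    exact Knutson.card_add_one_not_invertible h2 hρ hq (by exact_mod_cast h1) hφ hmul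
  · rcases Nat.odd_mod_four_iff.1 (Nat.odd_iff.1 hodd) with hq | hq
    · obtain ⟨V, _, _, _, ρ, hρ, hd⟩ := Knutson.exists_irreducible_card_sub_one h2 hψ hq
      obtain ⟨φ, hφ, hmul⟩ := hK _ ((Knutson.isIrrChar_iff _).2 ⟨V, _, _, ‹_›, ρ, hρ, rfl⟩)
      exact Knutson.card_sub_one_not_invertible h2 hρ hq hd hφ hmul
    · obtain ⟨V, _, _, _, ρ, hρ, hd⟩ := Knutson.exists_irreducible_card_add_one h2 hψ h5
      obtain ⟨φ, hφ, hmul⟩ := hK _ ((Knutson.isIrrChar_iff _).2 ⟨V, _, _, ‹_›, ρ, hρ, rfl⟩)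
      exact Knutson.card_add_one_not_invertible h2 hρ hq hd hφ hmul
end

section
/- Let G be a finite group having exactly one irreducible complex character of degree greater than 1. Then ℂ[G] is of Knutson type: every irreducible complex character χ of G admits a virtual character φ with χ·φ = ρ_reg. -/
open scoped ComplexOrder

section Representation

open Representation

variable {G : Type} [Group G]

/-- The character of an irreducible unbundled representation is an irreducible character. -/
theorem isIrrChar_of_isIrreducible [Finite G] {V : Type} [AddCommGroup V] [Module ℂ V]
    [FiniteDimensional ℂ V] (ρ : Representation ℂ G V) [IsIrreducible ρ] :
    IsIrrChar G ρ.character := by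
  have := Fintype.ofFinite G
  have hG : (Nat.card G : ℂ) ≠ 0 := NeZero.ne _
  have := invertibleOfNonzero hG
  refine ⟨FDRep.of ρ, (FDRep.simple_iff_char_is_norm_one _).2 ?_, rfl⟩
  have h := char_orthonormal ρ ρ
  rw [if_pos ⟨Representation.Equiv.refl ρ⟩, inv_mul_eq_one₀ hG] at h
  exact h.symm

/-- Characters are additive on complementary subrepresentations. -/
theorem Subrepresentation.character_add_of_isCompl {V : Type} [AddCommGroup V] [Module ℂ V]
    [FiniteDimensional ℂ V] {ρ : Representation ℂ G V} {p q : Subrepresentation ρ}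
    (h : IsCompl p q) :
    ρ.character = p.toRepresentation.character + q.toRepresentation.character := by
  have hpq : IsCompl p.toSubmodule q.toSubmodule :=
    ⟨disjoint_iff.2 (congrArg Subrepresentation.toSubmodule h.inf_eq_bot),
      codisjoint_iff.2 (congrArg Subrepresentation.toSubmodule h.sup_eq_top)⟩
  let N : Bool → Submodule ℂ V := fun b => cond b p.toSubmodule q.toSubmodule
  have hN : DirectSum.IsInternal N :=
    (DirectSum.isInternal_submodule_iff_isCompl N (i := true) (j := false) (by simp)
      (by ext b; cases b <;> simp)).2 hpq
  ext g
  have hf : ∀ b, Set.MapsTo (ρ g) (N b) (N b) := by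
    rintro (_ | _)
    · exact q.apply_mem_toSubmodule g
    · exact p.apply_mem_toSubmodule g
  rw [Representation.character, LinearMap.trace_eq_sum_trace_restrict hN hf, Fintype.sum_bool]
  rfl

/-- Every character of a finite group is a virtual character. -/
theorem isVirtualChar_character [Finite G] {V : Type} [AddCommGroup V] [Module ℂ V]
    [FiniteDimensional ℂ V] (ρ : Representation ℂ G V) : IsVirtualChar G ρ.character := by
  induction hn : Module.finrank ℂ V using Nat.strong_induction_on generalizing V with
  | _ n ih =>
  subst hn
  rcases subsingleton_or_nontrivial V with hV | hV
  · have h0 : ρ.character = 0 := by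
      ext g
      simp [Representation.character, Subsingleton.elim (ρ g) 0]
    rw [h0]
    exact Submodule.zero_mem _
  by_cases hirr : IsIrreducible ρ
  · exact Submodule.subset_span (isIrrChar_of_isIrreducible ρ)
  have : Nontrivial (Subrepresentation ρ) :=
    ⟨⊥, ⊤, fun h => bot_ne_top (congrArg Subrepresentation.toSubmodule h)⟩
  obtain ⟨p, hp0, hp1⟩ : ∃ p : Subrepresentation ρ, p ≠ ⊥ ∧ p ≠ ⊤ := by
    by_contra! hp
    exact hirr { eq_bot_or_eq_top := fun p => or_iff_not_imp_left.2 (hp p) }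
  obtain ⟨q, hpq⟩ := exists_isCompl p
  have hlt : ∀ r : Subrepresentation ρ, r ≠ ⊤ →
      Module.finrank ℂ r.toSubmodule < Module.finrank ℂ V := fun r hr =>
    Submodule.finrank_lt fun h => hr (Subrepresentation.toSubmodule_injective h)
  have hq1 : q ≠ ⊤ := fun h => hp0 (by simpa [h] using hpq.inf_eq_bot)
  rw [Subrepresentation.character_add_of_isCompl hpq]
  exact Submodule.add_mem _ (ih _ (hlt p hp1) p.toRepresentation rfl)
    (ih _ (hlt q hq1) q.toRepresentation rfl)

/-- The representation of `G` on functions on `G` by right translation. -/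
def rightTranslation (G : Type) [Group G] : Representation ℂ G (G → ℂ) where
  toFun g := LinearMap.funLeft ℂ ℂ (· * g)
  map_one' := by ext; simp [LinearMap.funLeft]
  map_mul' g h := by ext; simp [LinearMap.funLeft, mul_assoc]

theorem character_rightTranslation [Finite G] : (rightTranslation G).character = regChar G := by
  classical
  have := Fintype.ofFinite G
  ext g
  rw [Representation.character, LinearMap.trace_eq_matrix_trace ℂ (Pi.basisFun ℂ G)]
  by_cases hg : g = 1
  · subst hg
    simp [regChar, Matrix.trace_one]
  · simp [regChar, hg, Matrix.trace, rightTranslation, LinearMap.funLeft]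

theorem isVirtualChar_regChar [Finite G] : IsVirtualChar G (regChar G) :=
  character_rightTranslation (G := G) ▸ isVirtualChar_character (rightTranslation G)

theorem isVirtualChar_one [Finite G] : IsVirtualChar G 1 := by
  have h : (Representation.trivial ℂ G ℂ).character = 1 := by
    ext g
    simp [Representation.character]
  exact h ▸ isVirtualChar_character (Representation.trivial ℂ G ℂ)

/-- The character of a one-dimensional representation is multiplicative. -/
theorem FDRep.character_mul_of_finrank_eq_one {L : FDRep ℂ G} (hL : Module.finrank ℂ L = 1)
    (g h : G) : L.character (g * h) = L.character g * L.character h := by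
  obtain ⟨a, ha⟩ := (LinearMap.existsUnique_eq_smul_id_of_finrank_eq_one hL (L.ρ g)).exists
  obtain ⟨b, hb⟩ := (LinearMap.existsUnique_eq_smul_id_of_finrank_eq_one hL (L.ρ h)).exists
  have key : ∀ c : ℂ, LinearMap.trace ℂ L (c • LinearMap.id) = c := fun c => by
    rw [map_smul, LinearMap.trace_id, hL, Nat.cast_one, smul_eq_mul, mul_one]
  have hab : L.ρ (g * h) = (a * b) • LinearMap.id := by
    rw [map_mul, ha, hb, Module.End.mul_eq_comp, LinearMap.smul_comp, LinearMap.id_comp, smul_smul]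
  rw [FDRep.character, FDRep.character, FDRep.character, hab, ha, hb, key, key, key]

end Representation

section Character

variable {G : Type} [Group G]

theorem mul_regChar (f : G → ℂ) : f * regChar G = f 1 • regChar G := by
  ext g
  by_cases hg : g = 1 <;> simp [regChar, hg]

theorem IsIrrChar.exists_degree {χ : G → ℂ} [Finite G] (hχ : IsIrrChar G χ) :
    ∃ n : ℕ, 0 < n ∧ χ 1 = n := by
  obtain ⟨V, hV, rfl⟩ := hχ
  have := Fintype.ofFinite G
  refine ⟨Module.finrank ℂ V, Nat.pos_of_ne_zero fun h => ?_, V.char_one⟩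
  have hV0 := Module.finrank_zero_iff.1 h
  have h0 : ∀ g, V.character g = 0 := fun g => by
    rw [FDRep.character, Subsingleton.elim (V.ρ g) 0, map_zero]
  have hnorm := (FDRep.simple_iff_char_is_norm_one V).1 hV
  simp only [h0, zero_mul, Finset.sum_const_zero] at hnorm
  exact NeZero.ne (Nat.card G : ℂ) hnorm.symm

/-- Twisting an irreducible character by a linear character gives an irreducible character. -/
theorem IsIrrChar.mul_linear [Finite G] {χ l : G → ℂ} (hχ : IsIrrChar G χ) (hl : IsIrrChar G l)
    (hl1 : l 1 = 1) : IsIrrChar G (l * χ) := by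
  obtain ⟨V, hV, rfl⟩ := hχ
  obtain ⟨L, -, rfl⟩ := hl
  have := Fintype.ofFinite G
  have hL : Module.finrank ℂ L = 1 := by simpa using hl1
  refine ⟨CategoryTheory.MonoidalCategoryStruct.tensorObj L V,
    (FDRep.simple_iff_char_is_norm_one _).2 ?_, (FDRep.char_tensor L V).symm⟩
  rw [← (FDRep.simple_iff_char_is_norm_one V).1 hV]
  refine Finset.sum_congr rfl fun g _ => ?_
  have h1 : L.character g * L.character g⁻¹ = 1 := by
    rw [← FDRep.character_mul_of_finrank_eq_one hL, mul_inv_cancel, hl1]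
  rw [FDRep.char_tensor, Pi.mul_apply, Pi.mul_apply]
  linear_combination V.character g * V.character g⁻¹ * h1

/-- The pairing `f ↦ ∑ g, f g * χ g⁻¹`. -/
def charPairing [Fintype G] (χ : G → ℂ) : (G → ℂ) →ₗ[ℂ] ℂ where
  toFun f := ∑ g, f g * χ g⁻¹
  map_add' f₁ f₂ := by simp [add_mul, Finset.sum_add_distrib]
  map_smul' c f := by simp [Finset.mul_sum, mul_assoc]

theorem charPairing_regChar [Fintype G] (χ : G → ℂ) :
    charPairing χ (regChar G) = Nat.card G * χ 1 := by
  classical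
  simp [charPairing, regChar, ite_mul]

theorem IsIrrChar.charPairing_self [Fintype G] {χ : G → ℂ} (hχ : IsIrrChar G χ) :
    charPairing χ χ = Nat.card G := by
  obtain ⟨V, hV, rfl⟩ := hχ
  exact (FDRep.simple_iff_char_is_norm_one V).1 hV

theorem IsIrrChar.charPairing_of_ne [Fintype G] {χ ψ : G → ℂ} (hχ : IsIrrChar G χ)
    (hψ : IsIrrChar G ψ) (h : ψ ≠ χ) : charPairing χ ψ = 0 := by
  obtain ⟨V, hV, rfl⟩ := hχ
  obtain ⟨W, hW, rfl⟩ := hψ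
  have hG : (Nat.card G : ℂ) ≠ 0 := NeZero.ne _
  have := invertibleOfNonzero hG
  have ho := FDRep.char_orthonormal W V
  rw [if_neg fun ⟨i⟩ => h (FDRep.char_iso i)] at ho
  exact (mul_eq_zero.1 ho).resolve_left (inv_ne_zero hG)

theorem IsIrrChar.exists_charPairing_mul_self [Fintype G] {χ : G → ℂ} (hχ : IsIrrChar G χ) :
    ∃ n : ℕ, charPairing χ (χ * χ) = Nat.card G * n := by
  obtain ⟨V, hV, rfl⟩ := hχ
  have hG : (Nat.card G : ℂ) ≠ 0 := NeZero.ne _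
  have := invertibleOfNonzero hG
  refine ⟨Module.finrank ℂ (Quiver.Hom V (CategoryTheory.MonoidalCategoryStruct.tensorObj V V)),
    (inv_mul_eq_iff_eq_mul₀ hG).1 ?_⟩
  rw [← FDRep.scalar_product_char_eq_finrank_equivariant, FDRep.char_tensor]
  rfl

/-- The regular character is `χ 1 • χ` plus a part on which `χ` is an integral eigenvector, if `χ`
is the only irreducible character of degree greater than one. -/
theorem exists_regChar_mul_eq [Finite G] {χ : G → ℂ} (hχ : IsIrrChar G χ)
    (hlin : ∀ ψ, IsIrrChar G ψ → ψ ≠ χ → ψ 1 = 1) (hχ1 : χ 1 ≠ 1) :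
    ∃ m : ℤ, regChar G * χ = χ 1 • (χ * χ) + (m : ℂ) • χ := by
  have := Fintype.ofFinite G
  have hG : (Nat.card G : ℂ) ≠ 0 := NeZero.ne _
  have key : ∀ f : G → ℂ, IsVirtualChar G f → ∃ (a : ℂ) (m : ℤ),
      charPairing χ f = Nat.card G * a ∧ f * χ = a • (χ * χ) + (m : ℂ) • χ := by
    intro f hf
    induction hf using Submodule.span_induction with
    | mem ψ hψ =>
      by_cases h : ψ = χ
      · exact ⟨1, 0, by rw [h, hχ.charPairing_self, mul_one], by simp [h]⟩
      · refine ⟨0, 1, by rw [hχ.charPairing_of_ne hψ h, mul_zero], ?_⟩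
        have h1 := hlin ψ hψ h
        have : ψ * χ = χ := by
          by_contra hne
          exact hχ1 (by simpa [h1] using hlin _ (hχ.mul_linear hψ h1) hne)
        simp [this]
    | zero => exact ⟨0, 0, by simp, by simp⟩
    | add f₁ f₂ _ _ h₁ h₂ =>
      obtain ⟨a₁, m₁, e₁, e₁'⟩ := h₁
      obtain ⟨a₂, m₂, e₂, e₂'⟩ := h₂
      refine ⟨a₁ + a₂, m₁ + m₂, by rw [map_add, e₁, e₂, mul_add], ?_⟩
      rw [add_mul, e₁', e₂']
      push_cast
      module
    | smul c f _ h =>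
      obtain ⟨a, m, e, e'⟩ := h
      refine ⟨c * a, c * m, by rw [map_zsmul, e, zsmul_eq_mul]; ring, ?_⟩
      rw [smul_mul_assoc, e', ← Int.cast_smul_eq_zsmul ℂ]
      push_cast
      module
  obtain ⟨a, m, ha, hm⟩ := key _ isVirtualChar_regChar
  rw [charPairing_regChar] at ha
  exact ⟨m, mul_left_cancel₀ hG ha ▸ hm⟩

end Character

/-- A finite group with exactly one irreducible character of degree
greater than one is of Knutson type. -/
theorem unique_higher_degree_isKnutsonType (G : Type) [Group G] [Finite G]
    (h : ∃! χ : G → ℂ, IsIrrChar G χ ∧ ∃ n : ℕ, 1 < n ∧ χ 1 = (n : ℂ)) :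
    IsKnutsonType G := by
  have := Fintype.ofFinite G
  have hG : (Nat.card G : ℂ) ≠ 0 := NeZero.ne _
  obtain ⟨χ, ⟨hχ, d, hd, hχd⟩, huniq⟩ := h
  have hlin : ∀ ψ, IsIrrChar G ψ → ψ ≠ χ → ψ 1 = 1 := by
    intro ψ hψ hne
    obtain ⟨n, hn, hψn⟩ := hψ.exists_degree
    have : ¬ 1 < n := fun h => hne (huniq ψ ⟨hψ, n, h, hψn⟩)
    rw [hψn, show n = 1 by omega, Nat.cast_one]
  have hχ1 : χ 1 ≠ 1 := by
    rw [hχd]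
    exact_mod_cast hd.ne'
  have hd0 : (d : ℂ) ≠ 0 := by
    exact_mod_cast (by omega : d ≠ 0)
  intro ψ hψ
  by_cases hne : ψ = χ
  · subst hne
    obtain ⟨m, hm⟩ := exists_regChar_mul_eq hχ hlin hχ1
    obtain ⟨n, hn⟩ := hχ.exists_charPairing_mul_self
    rw [mul_comm, mul_regChar, hχd] at hm
    have hmn : (m : ℂ) = d * (d - n) := by
      have h := congrArg (charPairing ψ) hm
      rw [map_add, map_smul, map_smul, map_smul, charPairing_regChar, hn, hχ.charPairing_self,
        hχd] at h
      simp only [smul_eq_mul] at h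
      apply mul_left_cancel₀ hG
      linear_combination -h
    refine ⟨ψ + ((d : ℤ) - n) • (1 : G → ℂ), Submodule.add_mem _ (Submodule.subset_span hχ)
      (Submodule.smul_mem _ _ isVirtualChar_one), ?_⟩
    apply smul_right_injective _ hd0
    simp only
    rw [hm, hmn]
    ext g
    simp
    ring
  · exact ⟨regChar G, isVirtualChar_regChar, by rw [mul_regChar, hlin ψ hψ hne, one_smul]⟩
end
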